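/- arXiv:2202.12798 — 7 statements merged into one kernel-verified Lean document; each statement's English description precedes it below -/
import Mathlib

section
/- Let A and B be positive elements and X an arbitrary element of a unital C*-algebra 𝒜 with unit I. Then the 2×2 operator matrix [[A, X], [X*, B]] is positive in M₂(𝒜) if and only if B ≥ X*(A + εI)⁻¹X for every real ε > 0. -/
/-- An element of a C*-algebra is positive if and only if it is of the form `star b * b`. -/
def IsPosElem {A : Type*} [Mul A] [Star A] (a : A) : Prop := ∃ b : A, a = star b * b

theorem exists_star_mul_self_of_nonneg {E : Type*} [NonUnitalCStarAlgebra E] [PartialOrder E]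
    [StarOrderedRing E] {a : E} (h : 0 ≤ a) : ∃ b : E, a = star b * b :=
  CStarAlgebra.nonneg_iff_eq_star_mul_self.1 h

open scoped Matrix in
open Filter Topology in
/-- Lemma 1.1: for positive `A, B` in a unital C*-algebra, the operator matrix
`[[A, X], [X*, B]]` is positive in `M₂(𝒜)` if and only if
`B ≥ X* (A + ε•1)⁻¹ X` for every real `ε > 0`. -/
theorem matrix_pos_iff_schur_complement {𝒜 : Type*} [CStarAlgebra 𝒜]
    (A B X : 𝒜) (hA : IsPosElem A) (hB : IsPosElem B) :
    IsPosElem !![A, X; star X, B] ↔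
      ∀ ε : ℝ, 0 < ε →
        IsPosElem (B - star X * Ring.inverse (A + (ε : ℂ) • 1) * X) := by
  let _ : PartialOrder 𝒜 := CStarAlgebra.spectralOrder 𝒜
  let _ : StarOrderedRing 𝒜 := CStarAlgebra.spectralOrderedRing 𝒜
  have pos_iff : ∀ a : 𝒜, IsPosElem a ↔ 0 ≤ a := fun a =>
    CStarAlgebra.nonneg_iff_eq_star_mul_self.symm
  have hA0 : 0 ≤ A := (pos_iff A).1 hA
  have hsm : ∀ ε : ℝ, (ε : ℂ) • (1 : 𝒜) = algebraMap ℝ 𝒜 ε := fun ε => by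
    rw [Algebra.algebraMap_eq_smul_one]; exact Complex.coe_smul ε (1 : 𝒜)
  have hε0 : ∀ ε : ℝ, 0 < ε → (0 : 𝒜) ≤ algebraMap ℝ 𝒜 ε := fun ε h =>
    algebraMap_nonneg 𝒜 h.le
  -- the inverse
  have key : ∀ ε : ℝ, 0 < ε → ∃ C : 𝒜, Ring.inverse (A + (ε : ℂ) • 1) = C ∧ star C = C ∧
      C * (A + algebraMap ℝ 𝒜 ε) = 1 ∧ (A + algebraMap ℝ 𝒜 ε) * C = 1 := by
    intro ε hε
    have hu : IsUnit (A + algebraMap ℝ 𝒜 ε) := by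
      have h1 : IsUnit (algebraMap ℝ 𝒜 ε) := (IsUnit.mk0 ε hε.ne').map _
      exact CStarAlgebra.isUnit_of_le (algebraMap ℝ 𝒜 ε) (le_add_of_nonneg_left hA0)
        (h1.isStrictlyPositive (hε0 ε hε))
    have hsa : star (A + algebraMap ℝ 𝒜 ε) = A + algebraMap ℝ 𝒜 ε :=
      (IsSelfAdjoint.of_nonneg (add_nonneg hA0 (hε0 ε hε))).star_eq
    refine ⟨_, rfl, ?_, ?_, ?_⟩
    · rw [hsm, ← Ring.inverse_star, hsa]
    · rw [hsm]; exact Ring.inverse_mul_cancel _ hu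
    · rw [hsm]; exact Ring.mul_inverse_cancel _ hu
  constructor
  · rintro ⟨N, hN⟩ ε hε
    obtain ⟨C, hC, hCs, hC1, hC2⟩ := key ε hε
    rw [hC, pos_iff]
    have e00 : A = star (N 0 0) * N 0 0 + star (N 1 0) * N 1 0 := by
      have := congrFun (congrFun hN 0) 0
      simpa [Matrix.mul_apply, Fin.sum_univ_two, Matrix.star_apply] using this
    have e01 : X = star (N 0 0) * N 0 1 + star (N 1 0) * N 1 1 := by
      have := congrFun (congrFun hN 0) 1
      simpa [Matrix.mul_apply, Fin.sum_univ_two, Matrix.star_apply] using this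
    have e10 : star X = star (N 0 1) * N 0 0 + star (N 1 1) * N 1 0 := by
      have := congrFun (congrFun hN 1) 0
      simpa [Matrix.mul_apply, Fin.sum_univ_two, Matrix.star_apply] using this
    have e11 : B = star (N 0 1) * N 0 1 + star (N 1 1) * N 1 1 := by
      have := congrFun (congrFun hN 1) 1
      simpa [Matrix.mul_apply, Fin.sum_univ_two, Matrix.star_apply] using this
    have h : B - star X * C * X =
        star (N 0 1 - N 0 0 * (C * X)) * (N 0 1 - N 0 0 * (C * X))
        + star (N 1 1 - N 1 0 * (C * X)) * (N 1 1 - N 1 0 * (C * X))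
        + star (C * X) * algebraMap ℝ 𝒜 ε * (C * X) := by
      have h1 : star (N 0 1 - N 0 0 * (C * X)) * (N 0 1 - N 0 0 * (C * X))
        + star (N 1 1 - N 1 0 * (C * X)) * (N 1 1 - N 1 0 * (C * X))
        = (star (N 0 1) * N 0 1 + star (N 1 1) * N 1 1)
          - (star (N 0 1) * N 0 0 + star (N 1 1) * N 1 0) * (C * X)
          - star (C * X) * (star (N 0 0) * N 0 1 + star (N 1 0) * N 1 1)
          + star (C * X) * (star (N 0 0) * N 0 0 + star (N 1 0) * N 1 0) * (C * X) := by
        simp only [star_sub, star_mul]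
        noncomm_ring
      rw [h1, ← e00, ← e01, ← e10, ← e11]
      have h2 : star (C * X) * A * (C * X) + star (C * X) * algebraMap ℝ 𝒜 ε * (C * X)
          = star (C * X) * X := by
        calc _ = star (C * X) * ((A + algebraMap ℝ 𝒜 ε) * C) * X := by noncomm_ring
          _ = _ := by rw [hC2, mul_one]
      rw [add_assoc, h2, mul_assoc]
      abel
    rw [h]
    exact add_nonneg (add_nonneg (star_mul_self_nonneg _) (star_mul_self_nonneg _))
      (star_left_conjugate_nonneg (hε0 ε hε) _)
  · intro H
    have hpos : ∀ ε : ℝ, 0 < ε → (0 : CStarMatrix (Fin 2) (Fin 2) 𝒜) ≤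
        CStarMatrix.ofMatrix !![A, X; star X, B]
          + (ε : ℂ) • CStarMatrix.ofMatrix !![(1 : 𝒜), 0; 0, 0] := by
      intro ε hε
      obtain ⟨C, hC, hCs, hC1, hC2⟩ := key ε hε
      obtain ⟨D, hD⟩ := H ε hε
      rw [hC] at hD
      obtain ⟨S, hS⟩ := (pos_iff _).2 (add_nonneg hA0 (hε0 ε hε))
      have hBD : B = star X * C * X + star D * D := by rw [← hD]; abel
      have : CStarMatrix.ofMatrix !![A, X; star X, B]
          + (ε : ℂ) • CStarMatrix.ofMatrix !![(1 : 𝒜), 0; 0, 0]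
          = star (CStarMatrix.ofMatrix !![S, S * C * X; 0, D])
            * CStarMatrix.ofMatrix !![S, S * C * X; 0, D] := by
        have g1 : star S * (S * C * X) = X := by
          rw [← mul_assoc, ← mul_assoc, ← hS, hC2, one_mul]
        have g2 : star X * (C * star S) * S = star X := by
          rw [mul_assoc, mul_assoc, ← hS, hC1, mul_one]
        have g3 : star X * (C * star S) * (S * C * X) = star X * C * X := by
          rw [mul_assoc, mul_assoc, g1, mul_assoc]
        ext i j
        fin_cases i <;> fin_cases j <;>
          simp [CStarMatrix.mul_apply, Fin.sum_univ_two, CStarMatrix.star_apply, hCs, g1, g2, g3]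
        · rw [← hS, Algebra.algebraMap_eq_smul_one]
        · exact hBD
      rw [this]
      exact star_mul_self_nonneg _
    have hlim : Tendsto (fun ε : ℝ => CStarMatrix.ofMatrix !![A, X; star X, B]
          + (ε : ℂ) • CStarMatrix.ofMatrix !![(1 : 𝒜), 0; 0, 0]) (𝓝[>] 0)
          (𝓝 (CStarMatrix.ofMatrix !![A, X; star X, B])) := by
      have hc : Continuous (fun ε : ℝ => CStarMatrix.ofMatrix !![A, X; star X, B]
          + (ε : ℂ) • CStarMatrix.ofMatrix !![(1 : 𝒜), 0; 0, 0]) := by fun_prop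
      have := (hc.tendsto 0).mono_left (nhdsWithin_le_nhds (s := Set.Ioi 0))
      simpa only [Complex.ofReal_zero, zero_smul, add_zero] using this
    have h0 : (0 : CStarMatrix (Fin 2) (Fin 2) 𝒜) ≤ CStarMatrix.ofMatrix !![A, X; star X, B] :=
      ge_of_tendsto hlim (eventually_mem_nhdsWithin.mono fun ε hε => hpos ε hε)
    obtain ⟨N, hN⟩ := exists_star_mul_self_of_nonneg h0
    exact ⟨CStarMatrix.ofMatrix.symm N, hN⟩
end

section
/- Let Φ : 𝒜₁ ⊕ ⋯ ⊕ 𝒜_k → ℬ be a tracial positive multilinear map from a direct sum of unital C*-algebras into a von Neumann algebra ℬ. Then there exist a compact Hausdorff space Ω, a tracial positive linear map φ₁ : 𝒜₁ ⊕ ⋯ ⊕ 𝒜_k → C(Ω) and a tracial positive map φ₂ : C(Ω) → ℬ such that Φ = φ₂ ∘ φ₁. Moreover, if Φ is unital, then φ₁ and φ₂ can be chosen to be unital. -/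
universe u

section Helpers

open scoped ComplexOrder

/-- The complex span of commutators. -/
noncomputable def commSpan (A : Type*) [CStarAlgebra A] : Submodule ℂ A :=
  Submodule.span ℂ {c | ∃ a b : A, c = a * b - b * a}

/-- Positive up to commutators and an arbitrarily small multiple of the unit. -/
def ApproxPos {A : Type*} [CStarAlgebra A] (a : A) : Prop :=
  ∀ ε : ℝ, 0 < ε → ∃ p : A, IsPosElem p ∧ a + (ε : ℂ) • 1 - p ∈ commSpan A

/-- The set of tracial states. -/
def TrSt (A : Type*) [CStarAlgebra A] : Set (WeakDual ℂ A) :=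
  {τ | (∀ a : A, 0 ≤ τ (star a * a)) ∧ (∀ a b : A, τ (a * b) = τ (b * a)) ∧ τ 1 = 1 ∧
    ∀ a, ‖τ a‖ ≤ ‖a‖}

theorem isPosElem_iff {A : Type*} [CStarAlgebra A] [PartialOrder A] [StarOrderedRing A] (a : A) :
    IsPosElem a ↔ 0 ≤ a := by
  constructor
  · rintro ⟨b, rfl⟩; exact star_mul_self_nonneg b
  · intro h
    exact CStarAlgebra.nonneg_iff_eq_star_mul_self.mp h

theorem isPosElem_add {A : Type*} [CStarAlgebra A] {a b : A} (ha : IsPosElem a)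
    (hb : IsPosElem b) : IsPosElem (a + b) := by
  let _ := CStarAlgebra.spectralOrder A
  have := CStarAlgebra.spectralOrderedRing A
  rw [isPosElem_iff] at *
  exact add_nonneg ha hb

theorem isPosElem_smul {A : Type*} [CStarAlgebra A] {a : A} (ha : IsPosElem a)
    {r : ℝ} (hr : 0 ≤ r) : IsPosElem ((r : ℂ) • a) := by
  obtain ⟨b, rfl⟩ := ha
  refine ⟨((√r : ℝ) : ℂ) • b, ?_⟩
  simp only [star_smul, smul_mul_smul_comm]
  congr 1
  simp only [RCLike.star_def, Complex.conj_ofReal]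
  rw [← Complex.ofReal_mul, Real.mul_self_sqrt hr]

theorem isPosElem_star {A : Type*} [CStarAlgebra A] {a : A} (ha : IsPosElem a) : star a = a := by
  obtain ⟨b, rfl⟩ := ha
  simp

theorem isPosElem_norm_sub {A : Type*} [CStarAlgebra A] {a : A} (ha : star a = a) {r : ℝ}
    (hr : ‖a‖ ≤ r) : IsPosElem ((r : ℂ) • 1 - a) := by
  let _ := CStarAlgebra.spectralOrder A
  have := CStarAlgebra.spectralOrderedRing A
  rw [isPosElem_iff, sub_nonneg]
  have h1 : a ≤ algebraMap ℝ A ‖a‖ := IsSelfAdjoint.le_algebraMap_norm_self (a := a) ha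
  have h2 : algebraMap ℝ A ‖a‖ ≤ algebraMap ℝ A r := algebraMap_mono A hr
  have h3 : algebraMap ℝ A r = (r : ℂ) • 1 := by
    rw [Algebra.algebraMap_eq_smul_one]; simp
  exact h3 ▸ h1.trans h2

theorem commSpan_star {A : Type*} [CStarAlgebra A] {a : A} (ha : a ∈ commSpan A) :
    star a ∈ commSpan A := by
  unfold commSpan at *
  induction ha using Submodule.span_induction with
  | mem x h =>
    obtain ⟨a, b, rfl⟩ := h
    apply Submodule.subset_span
    exact ⟨star b, star a, by simp⟩
  | zero => simp
  | add x y _ _ hx hy => rw [star_add]; exact add_mem hx hy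
  | smul c x _ hx => rw [star_smul]; exact Submodule.smul_mem _ _ hx

/-- The cone used for separation. -/
noncomputable def sepCone (A : Type*) [CStarAlgebra A] : PointedCone ℝ A where
  carrier := {a | ∃ p, IsPosElem p ∧ a + star a - p ∈ commSpan A}
  zero_mem' := ⟨0, ⟨0, by simp⟩, by simp⟩
  add_mem' := by
    rintro a b ⟨p, hp, h⟩ ⟨q, hq, h'⟩
    refine ⟨p + q, isPosElem_add hp hq, ?_⟩
    convert add_mem h h' using 1
    rw [star_add]; abel
  smul_mem' := by
    rintro c a ⟨p, hp, h⟩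
    refine ⟨((c : ℝ) : ℂ) • p, isPosElem_smul hp c.2, ?_⟩
    have : c • a = ((c : ℝ) : ℂ) • a := by
      change (c : ℝ) • a = _
      simp
    rw [this]
    convert Submodule.smul_mem _ ((c : ℝ) : ℂ) h using 1
    rw [star_smul, smul_sub, smul_add, RCLike.star_def, Complex.conj_ofReal]

theorem mem_sepCone {A : Type*} [CStarAlgebra A] {a : A} :
    a ∈ sepCone A ↔ ∃ p, IsPosElem p ∧ a + star a - p ∈ commSpan A := Iff.rfl

theorem trSt_of_functional {A : Type*} [CStarAlgebra A] (f : StrongDual ℝ A)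
    (hf : ∀ a ∈ sepCone A, 0 ≤ f a) {h : A} (hh : f h < 0) :
    ∃ τ ∈ TrSt A, (τ h).re < 0 := by
  have hbound : ∀ a : A, f a ≤ f 1 * ‖a‖ := by
    intro a
    have h0 : ‖a + star a‖ ≤ 2 * ‖a‖ := by
      calc _ ≤ ‖a‖ + ‖star a‖ := norm_add_le _ _
        _ = _ := by rw [norm_star]; ring
    have := hf (((‖a‖ : ℝ) : ℂ) • 1 - a) ⟨_, isPosElem_norm_sub (by simp [add_comm]) h0, by
      convert Submodule.zero_mem _ using 1
      simp only [star_sub, star_smul, star_one, RCLike.star_def, Complex.conj_ofReal]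
      push_cast
      module⟩
    rw [map_sub, Complex.coe_smul, map_smul, smul_eq_mul] at this
    linarith
  have hone : 0 < f 1 := by
    by_contra hc
    have h1 := hbound (-h)
    rw [map_neg] at h1
    nlinarith [norm_nonneg (-h)]
  have hK : ∀ c ∈ commSpan A, f c = 0 := by
    intro c hc
    have h1 := hf c ⟨0, ⟨0, by simp⟩, by simpa using add_mem hc (commSpan_star hc)⟩
    have hc' := neg_mem hc
    have h2 := hf (-c) ⟨0, ⟨0, by simp⟩, by simpa using add_mem hc' (commSpan_star hc')⟩
    rw [map_neg] at h2
    linarith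
  have hI : ∀ a : A, star a = a → f (Complex.I • a) = 0 := by
    intro a ha
    have h1 := hf (Complex.I • a) ⟨0, ⟨0, by simp⟩, by simp [ha]⟩
    have h2 := hf (-(Complex.I • a)) ⟨0, ⟨0, by simp⟩, by simp [ha]⟩
    rw [map_neg] at h2
    linarith
  have hpos : ∀ p : A, IsPosElem p → 0 ≤ f p := by
    intro p hp
    refine hf p ⟨p + p, isPosElem_add hp hp, ?_⟩
    rw [isPosElem_star hp]; simp
  let g : StrongDual ℂ A := StrongDual.extendRCLike (𝕜 := ℂ) f
  have hg : ∀ a, g a = (f a : ℂ) - Complex.I * (f (Complex.I • a) : ℂ) := fun a => rfl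
  have hnorm : ‖g‖ ≤ f 1 := by
    have : ‖g‖ = ‖f‖ := StrongDual.norm_extendRCLike f
    rw [this]
    refine ContinuousLinearMap.opNorm_le_bound _ hone.le fun a => ?_
    rw [Real.norm_eq_abs, abs_le]
    have h1 := hbound (-a)
    rw [map_neg, norm_neg] at h1
    exact ⟨by linarith, hbound a⟩
  let τ : StrongDual ℂ A := (((f 1)⁻¹ : ℝ) : ℂ) • g
  have hτ : ∀ a, τ a = (((f 1)⁻¹ : ℝ) : ℂ) * g a := fun a => rfl
  refine ⟨StrongDual.toWeakDual τ, ⟨?_, ?_, ?_, ?_⟩, ?_⟩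
  · intro a
    change 0 ≤ τ _
    rw [hτ, hg, hI _ (by simp)]
    have := hpos (star a * a) ⟨a, rfl⟩
    have h3 : 0 ≤ (f 1)⁻¹ * f (star a * a) := by positivity
    simpa using (by exact_mod_cast h3 : (0:ℂ) ≤ (((f 1)⁻¹ * f (star a * a) : ℝ) : ℂ))
  · intro a b
    change τ _ = τ _
    rw [← sub_eq_zero, ← map_sub]
    have hc : a * b - b * a ∈ commSpan A := Submodule.subset_span ⟨a, b, rfl⟩
    rw [hτ, hg, hK _ hc, hK _ (Submodule.smul_mem _ _ hc)]
    simp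
  · change τ _ = _
    rw [hτ, hg, hI _ (by simp)]
    have : (f 1 : ℂ) ≠ 0 := by exact_mod_cast hone.ne'
    simp [this]
  · intro a
    change ‖τ a‖ ≤ _
    rw [hτ, norm_mul, Complex.norm_real, Real.norm_eq_abs, abs_of_pos (inv_pos.mpr hone)]
    have h4 := g.le_of_opNorm_le hnorm a
    rw [inv_mul_le_iff₀ hone]
    exact h4
  · change (τ h).re < 0
    rw [hτ, Complex.re_ofReal_mul, hg]
    simp
    exact mul_neg_of_pos_of_neg (inv_pos.mpr hone) hh

theorem approxPos_of_trSt {A : Type*} [CStarAlgebra A] {h : A} (hs : star h = h)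
    (H : ∀ τ ∈ TrSt A, 0 ≤ (τ h).re) : ApproxPos h := by
  have hcl : h ∈ closure (sepCone A : Set A) := by
    by_contra hc
    let C : ProperCone ℝ A := Submodule.closure (sepCone A)
    have hC : h ∉ C := hc
    obtain ⟨f, hf, hfh⟩ := C.hyperplane_separation_point hC
    obtain ⟨τ, hτ, h'⟩ := trSt_of_functional f
      (fun a ha => hf a (show a ∈ closure (sepCone A : Set A) from subset_closure ha)) hfh
    exact absurd (H τ hτ) (not_le.mpr h')
  intro ε hε
  obtain ⟨y, ⟨p, hp, hy⟩, hd⟩ := Metric.mem_closure_iff.mp hcl ε hε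
  rw [dist_eq_norm] at hd
  have hn : ‖(y - h) + star (y - h)‖ ≤ 2 * ε := by
    calc _ ≤ ‖y - h‖ + ‖star (y - h)‖ := norm_add_le _ _
      _ ≤ _ := by rw [norm_star, norm_sub_rev]; linarith
  have hq := isPosElem_norm_sub (by simp [add_comm]) hn
  have hr := isPosElem_smul (isPosElem_add hp hq) (r := 1/2) (by norm_num)
  refine ⟨_, hr, ?_⟩
  convert Submodule.smul_mem _ (1/2 : ℂ) hy using 1
  push_cast
  simp only [star_sub, hs]
  module

theorem trSt_pos {A : Type*} [CStarAlgebra A] {τ : WeakDual ℂ A} (hτ : τ ∈ TrSt A) {p : A}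
    (hp : IsPosElem p) : 0 ≤ τ p := by
  obtain ⟨b, rfl⟩ := hp
  exact hτ.1 b

theorem span_isPosElem {A : Type*} [CStarAlgebra A] (a : A) :
    a ∈ Submodule.span ℂ {p : A | IsPosElem p} := by
  let _ := CStarAlgebra.spectralOrder A
  have := CStarAlgebra.spectralOrderedRing A
  simp only [isPosElem_iff]
  rw [CStarAlgebra.span_nonneg]
  trivial

theorem trSt_star {A : Type*} [CStarAlgebra A] {τ : WeakDual ℂ A} (hτ : τ ∈ TrSt A) (a : A) :
    τ (star a) = star (τ a) := by
  induction span_isPosElem a using Submodule.span_induction with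
  | mem x h =>
    rw [isPosElem_star h]
    exact (IsSelfAdjoint.of_nonneg (trSt_pos hτ h)).symm
  | zero => simp
  | add x y _ _ hx hy => rw [star_add, map_add, map_add, star_add, hx, hy]
  | smul c x _ hx => rw [star_smul, map_smul, map_smul, star_smul, hx]

theorem approxPos_of_isPosElem {A : Type*} [CStarAlgebra A] {p : A} (hp : IsPosElem p) :
    ApproxPos p := by
  apply approxPos_of_trSt (isPosElem_star hp)
  intro τ hτ
  exact (Complex.nonneg_iff.mp (trSt_pos hτ hp)).1

theorem isCompact_trSt (A : Type*) [CStarAlgebra A] : IsCompact (TrSt A) := by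
  refine (WeakDual.isCompact_closedBall (𝕜 := ℂ) (0 : StrongDual ℂ A) 1).of_isClosed_subset ?_ ?_
  · have hev : ∀ a : A, Continuous fun τ : WeakDual ℂ A => τ a := fun a =>
      WeakDual.eval_continuous a
    simp only [TrSt, Set.ofPred_and, Set.ofPred_forall]
    refine .inter ?_ (.inter ?_ (.inter ?_ ?_))
    · exact isClosed_iInter fun a => isClosed_le continuous_const (hev _)
    · exact isClosed_iInter fun a => isClosed_iInter fun b => isClosed_eq (hev _) (hev _)
    · exact isClosed_eq (hev _) continuous_const
    · exact isClosed_iInter fun a => isClosed_le (hev _).norm continuous_const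
  · intro τ hτ
    change WeakDual.toStrongDual τ ∈ Metric.closedBall 0 1
    rw [mem_closedBall_zero_iff]
    refine ContinuousLinearMap.opNorm_le_bound _ zero_le_one fun a => ?_
    rw [one_mul]
    exact hτ.2.2.2 a


section Multi

variable {k : ℕ} {A : Fin k → Type u} [∀ i, CStarAlgebra (A i)] {B : Type*} [CStarAlgebra B]
  (Φ : MultilinearMap ℂ A B)

open Function

theorem multi_comm (htr : ∀ a b : ∀ i, A i, Φ (a * b) = Φ (b * a)) (x : ∀ i, A i) (i : Fin k)
    {c : A i} (hc : c ∈ commSpan (A i)) : Φ (update x i c) = 0 := by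
  unfold commSpan at hc
  induction hc using Submodule.span_induction with
  | mem c h =>
    obtain ⟨a, b, rfl⟩ := h
    have := htr (update x i a) (update 1 i b)
    have h1 : update x i a * update (1 : ∀ i, A i) i b = update x i (a * b) := by
      ext j
      by_cases hj : j = i
      · subst hj; simp
      · simp [hj]
    have h2 : update (1 : ∀ i, A i) i b * update x i a = update x i (b * a) := by
      ext j
      by_cases hj : j = i
      · subst hj; simp
      · simp [hj]
    rw [h1, h2] at this
    rw [Φ.map_update_sub, this, sub_self]
  | zero => exact Φ.map_update_zero x i
  | add a b _ _ ha hb => rw [Φ.map_update_add, ha, hb, add_zero]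
  | smul r a _ ha => rw [Φ.map_update_smul, ha, smul_zero]

theorem isPosElem_of_limit {a b : B} (h : ∀ ε : ℝ, 0 < ε → IsPosElem (a + (ε : ℂ) • b)) :
    IsPosElem a := by
  let _ := CStarAlgebra.spectralOrder B
  have := CStarAlgebra.spectralOrderedRing B
  simp only [isPosElem_iff] at *
  have hcont : Continuous fun ε : ℝ => a + (ε : ℂ) • b := by fun_prop
  have ht : Filter.Tendsto (fun ε : ℝ => a + (ε : ℂ) • b) (nhdsWithin 0 (Set.Ioi 0)) (nhds a) := by
    have := (hcont.tendsto 0).mono_left (nhdsWithin_le_nhds (s := Set.Ioi 0))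
    simpa using this
  exact ge_of_tendsto ht (by filter_upwards [self_mem_nhdsWithin] with ε hε using h ε hε)

theorem multi_approxPos
    (hpos : ∀ x : ∀ i, A i, (∀ i, IsPosElem (x i)) → IsPosElem (Φ x))
    (htr : ∀ a b : ∀ i, A i, Φ (a * b) = Φ (b * a)) (S : Finset (Fin k)) :
    ∀ x : ∀ i, A i, (∀ i, ApproxPos (x i)) → (∀ i, i ∉ S → IsPosElem (x i)) →
      IsPosElem (Φ x) := by
  induction S using Finset.induction_on with
  | empty => exact fun x _ h => hpos x fun i => h i (by simp)
  | insert i S hi ih =>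
    intro x hx hS
    apply isPosElem_of_limit (b := Φ (update x i 1))
    intro ε hε
    obtain ⟨p, hp, hK⟩ := hx i ε hε
    have h0 := multi_comm Φ htr x i hK
    rw [Φ.map_update_sub, Φ.map_update_add, Φ.map_update_smul, update_eq_self, sub_eq_zero] at h0
    rw [h0]
    apply ih
    · intro j
      by_cases hj : j = i
      · subst hj; simpa using approxPos_of_isPosElem hp
      · simpa [hj] using hx j
    · intro j hjS
      by_cases hj : j = i
      · subst hj; simpa using hp
      · simpa [hj] using hS j (by simp [hj, hjS])

theorem multi_zero_sa
    (hpos : ∀ x : ∀ i, A i, (∀ i, IsPosElem (x i)) → IsPosElem (Φ x))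
    (htr : ∀ a b : ∀ i, A i, Φ (a * b) = Φ (b * a)) (i : Fin k) {d : A i} (hs : star d = d)
    (hd : ∀ τ ∈ TrSt (A i), τ d = 0) (x : ∀ i, A i) (hx : ∀ j, j ≠ i → IsPosElem (x j)) :
    Φ (update x i d) = 0 := by
  have key : ∀ e : A i, star e = e → (∀ τ ∈ TrSt (A i), τ e = 0) →
      IsPosElem (Φ (update x i e)) := by
    intro e he hτ
    apply multi_approxPos Φ hpos htr Finset.univ _ _ (by simp)
    intro j
    by_cases hj : j = i
    · subst hj
      simpa using approxPos_of_trSt he fun τ h => by simp [hτ τ h]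
    · simpa [hj] using approxPos_of_isPosElem (hx j hj)
  have h1 := key d hs hd
  have h2 := key (-d) (by simp [hs]) (fun τ h => by simp [hd τ h])
  rw [Φ.map_update_neg] at h2
  let _ := CStarAlgebra.spectralOrder B
  have := CStarAlgebra.spectralOrderedRing B
  rw [isPosElem_iff] at h1 h2
  exact le_antisymm (neg_nonneg.mp h2) h1

theorem multi_zero_sa_all
    (hpos : ∀ x : ∀ i, A i, (∀ i, IsPosElem (x i)) → IsPosElem (Φ x))
    (htr : ∀ a b : ∀ i, A i, Φ (a * b) = Φ (b * a)) (i : Fin k) {d : A i} (hs : star d = d)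
    (hd : ∀ τ ∈ TrSt (A i), τ d = 0) (S : Finset (Fin k)) :
    ∀ (x : ∀ i, A i) (_ : ∀ j, j ∉ S → j ≠ i → IsPosElem (x j)), Φ (update x i d) = 0 := by
  induction S using Finset.induction_on with
  | empty => exact fun x hx => multi_zero_sa Φ hpos htr i hs hd x fun j => hx j (by simp)
  | insert l S hl ih =>
    intro x hx
    by_cases hli : l = i
    · exact ih x fun j hj hji => hx j (by simp [hj, hji, hli]) hji
    have key : ∀ y : A l, Φ (update (update x i d) l y) = 0 := by
      intro y
      induction span_isPosElem y using Submodule.span_induction with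
      | mem y hy =>
        rw [update_comm (Ne.symm hli)]
        apply ih
        intro j hj hji
        by_cases hjl : j = l
        · subst hjl; simpa using hy
        · simpa [hjl] using hx j (by simp [hj, hjl]) hji
      | zero => exact Φ.map_update_zero _ _
      | add a b _ _ ha hb => rw [Φ.map_update_add, ha, hb, add_zero]
      | smul r a _ ha => rw [Φ.map_update_smul, ha, smul_zero]
    simpa using key (update x i d l)

theorem multi_zero
    (hpos : ∀ x : ∀ i, A i, (∀ i, IsPosElem (x i)) → IsPosElem (Φ x))
    (htr : ∀ a b : ∀ i, A i, Φ (a * b) = Φ (b * a)) (i : Fin k) {d : A i}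
    (hd : ∀ τ ∈ TrSt (A i), τ d = 0) (x : ∀ i, A i) : Φ (update x i d) = 0 := by
  have h1 : Φ (update x i (d + star d)) = 0 :=
    multi_zero_sa_all Φ hpos htr i (by simp [add_comm])
      (fun τ h => by rw [map_add, trSt_star h, hd τ h]; simp) Finset.univ x (by simp)
  have h2 : Φ (update x i (Complex.I • (d - star d))) = 0 :=
    multi_zero_sa_all Φ hpos htr i (by simp [smul_sub]; abel)
      (fun τ h => by rw [map_smul, map_sub, trSt_star h, hd τ h]; simp) Finset.univ x (by simp)
  have h3 : d = (1 / 2 : ℂ) • (d + star d) + (-Complex.I / 2) • (Complex.I • (d - star d)) := by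
    rw [smul_smul]
    have : -Complex.I / 2 * Complex.I = 1 / 2 := by
      rw [div_mul_eq_mul_div, neg_mul, Complex.I_mul_I]; norm_num
    rw [this]; module
  rw [h3, Φ.map_update_add, Φ.map_update_smul, Φ.map_update_smul, h1, h2]
  simp

theorem multi_congr
    (hpos : ∀ x : ∀ i, A i, (∀ i, IsPosElem (x i)) → IsPosElem (Φ x))
    (htr : ∀ a b : ∀ i, A i, Φ (a * b) = Φ (b * a)) (y : ∀ i, A i) (S : Finset (Fin k)) :
    ∀ (x : ∀ i, A i) (_ : ∀ i, ∀ τ ∈ TrSt (A i), τ (x i) = τ (y i))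
      (_ : ∀ i, i ∉ S → x i = y i), Φ x = Φ y := by
  induction S using Finset.induction_on with
  | empty => exact fun x _ h => congrArg Φ (funext fun i => h i (by simp))
  | insert i S hi ih =>
    intro x hx hS
    have h0 := multi_zero Φ hpos htr i (d := x i - y i)
      (fun τ h => by rw [map_sub, hx i τ h, sub_self]) x
    rw [Φ.map_update_sub, update_eq_self, sub_eq_zero] at h0
    rw [h0]
    apply ih
    · intro j
      by_cases hj : j = i
      · subst hj; simp
      · simpa [hj] using hx j
    · intro j hjS
      by_cases hj : j = i
      · subst hj; simp
      · simpa [hj] using hS j (by simp [hj, hjS])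

theorem multi_pos
    (hpos : ∀ x : ∀ i, A i, (∀ i, IsPosElem (x i)) → IsPosElem (Φ x))
    (htr : ∀ a b : ∀ i, A i, Φ (a * b) = Φ (b * a)) (x : ∀ i, A i)
    (hx : ∀ i, ∀ τ ∈ TrSt (A i), 0 ≤ τ (x i)) : IsPosElem (Φ x) := by
  let y : ∀ i, A i := fun i => (1 / 2 : ℂ) • (x i + star (x i))
  have hxy : ∀ i, ∀ τ ∈ TrSt (A i), τ (x i) = τ (y i) := by
    intro i τ h
    change _ = τ ((1 / 2 : ℂ) • (x i + star (x i)))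
    have : star (τ (x i)) = τ (x i) := IsSelfAdjoint.of_nonneg (hx i τ h)
    rw [map_smul, map_add, trSt_star h, this, smul_eq_mul]
    ring
  rw [multi_congr Φ hpos htr y Finset.univ x hxy (by simp)]
  apply multi_approxPos Φ hpos htr Finset.univ _ _ (by simp)
  intro i
  apply approxPos_of_trSt
  · simp [y, add_comm]
  · intro τ h
    rw [← hxy i τ h]
    exact (Complex.nonneg_iff.mp (hx i τ h)).1

theorem multi_main
    (hpos : ∀ x : ∀ i, A i, (∀ i, IsPosElem (x i)) → IsPosElem (Φ x))
    (htr : ∀ a b : ∀ i, A i, Φ (a * b) = Φ (b * a)) :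
    ∃ (Ω : Type u) (_ : TopologicalSpace Ω) (_ : CompactSpace Ω) (_ : T2Space Ω)
      (φ₁ : (∀ i, A i) →ₗ[ℂ] C(Ω, ℂ)) (φ₂ : C(Ω, ℂ) → B),
      (∀ a : ∀ i, A i, IsPosElem a → IsPosElem (φ₁ a)) ∧
      (∀ a b : ∀ i, A i, φ₁ (a * b) = φ₁ (b * a)) ∧
      (∀ f : C(Ω, ℂ), IsPosElem f → IsPosElem (φ₂ f)) ∧
      (∀ f g : C(Ω, ℂ), φ₂ (f * g) = φ₂ (g * f)) ∧
      (∀ x : ∀ i, A i, Φ x = φ₂ (φ₁ x)) ∧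
      (Φ 1 = 1 → φ₁ 1 = 1 ∧ φ₂ 1 = 1) := by
  classical
  have hc : ∀ i, CompactSpace (TrSt (A i)) := fun i =>
    isCompact_iff_compactSpace.mp (isCompact_trSt (A i))
  let φ₁ : (∀ i, A i) →ₗ[ℂ] C((Σ i, TrSt (A i)), ℂ) :=
    { toFun := fun x => ⟨fun w => w.2.1 (x w.1), by
        refine continuous_sigma fun i => ?_
        exact (WeakDual.eval_continuous (x i)).comp continuous_subtype_val⟩
      map_add' := fun x y => by ext w; simp
      map_smul' := fun c x => by ext w; simp }
  have hφ : ∀ x w, φ₁ x w = w.2.1 (x w.1) := fun x w => rfl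
  let φ₂ : C((Σ i, TrSt (A i)), ℂ) → B := fun f =>
    if h : ∃ x, φ₁ x = f then Φ h.choose else 1
  have hcongr : ∀ x y, φ₁ x = φ₁ y → Φ x = Φ y := by
    intro x y h
    refine multi_congr Φ hpos htr y Finset.univ x (fun i τ hτ => ?_) (by simp)
    exact DFunLike.congr_fun h ⟨i, τ, hτ⟩
  have hfac : ∀ x, Φ x = φ₂ (φ₁ x) := by
    intro x
    have h : ∃ y, φ₁ y = φ₁ x := ⟨x, rfl⟩
    simp only [φ₂, dif_pos h]
    exact hcongr _ _ h.choose_spec.symm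
  have hone : φ₁ 1 = 1 := by
    ext w
    exact w.2.2.2.2.1
  refine ⟨(Σ i, TrSt (A i)), inferInstance, inferInstance, inferInstance, φ₁, φ₂,
    ?_, ?_, ?_, ?_, hfac, ?_⟩
  · rintro a ⟨b, rfl⟩
    have hnn : ∀ w, 0 ≤ φ₁ (star b * b) w := fun w => w.2.2.1 (b w.1)
    refine ⟨⟨fun w => ((√(φ₁ (star b * b) w).re : ℝ) : ℂ), by fun_prop⟩, ?_⟩
    ext w
    obtain ⟨h1, h2⟩ := Complex.nonneg_iff.mp (hnn w)
    change _ = star ((√(φ₁ (star b * b) w).re : ℝ) : ℂ) * ((√(φ₁ (star b * b) w).re : ℝ) : ℂ)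
    rw [RCLike.star_def, Complex.conj_ofReal, ← Complex.ofReal_mul, Real.mul_self_sqrt h1]
    exact Complex.ext (by rw [Complex.ofReal_re]) (by rw [← h2, Complex.ofReal_im])
  · intro a b
    ext w
    exact w.2.2.2.1 (a w.1) (b w.1)
  · rintro f ⟨g, hg⟩
    by_cases h : ∃ x, φ₁ x = f
    · obtain ⟨x, rfl⟩ := h
      rw [← hfac]
      refine multi_pos Φ hpos htr x fun i τ hτ => ?_
      have : τ (x i) = star (g ⟨i, τ, hτ⟩) * g ⟨i, τ, hτ⟩ := DFunLike.congr_fun hg ⟨i, τ, hτ⟩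
      rw [this]
      exact star_mul_self_nonneg _
    · simp only [φ₂, dif_neg h]
      exact ⟨1, by simp⟩
  · intro f g
    rw [mul_comm]
  · intro h
    exact ⟨hone, by rw [← hone, ← hfac, h]⟩

end Multi

end Helpers

/-- Theorem 3.7 (case (2): the codomain is a von Neumann algebra): every tracial positive
multilinear map `Φ : 𝒜₁ ⊕ ⋯ ⊕ 𝒜_k → ℬ` from a direct sum of unital C*-algebras into a
von Neumann algebra factors as `Φ = φ₂ ∘ φ₁`, where `φ₁` is a tracial positive linear map
into some `C(Ω)` (`Ω` compact Hausdorff) and `φ₂ : C(Ω) → ℬ` is a tracial positive map.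
Moreover, if `Φ` is unital, then `φ₁` and `φ₂` can be chosen to be unital. -/
theorem tracial_positive_multilinear_decomposition
    {k : ℕ} {A : Fin k → Type u} [∀ i, CStarAlgebra (A i)]
    {H : Type*} [NormedAddCommGroup H] [InnerProductSpace ℂ H] [CompleteSpace H]
    (N : VonNeumannAlgebra H)
    (Φ : MultilinearMap ℂ A ↥N.toStarSubalgebra)
    (hpos : ∀ x : ∀ i, A i, (∀ i, IsPosElem (x i)) → IsPosElem (Φ x))
    (htr : ∀ a b : ∀ i, A i, Φ (a * b) = Φ (b * a)) :
    ∃ (Ω : Type u) (_ : TopologicalSpace Ω) (_ : CompactSpace Ω) (_ : T2Space Ω)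
      (φ₁ : (∀ i, A i) →ₗ[ℂ] C(Ω, ℂ)) (φ₂ : C(Ω, ℂ) → ↥N.toStarSubalgebra),
      (∀ a : ∀ i, A i, IsPosElem a → IsPosElem (φ₁ a)) ∧
      (∀ a b : ∀ i, A i, φ₁ (a * b) = φ₁ (b * a)) ∧
      (∀ f : C(Ω, ℂ), IsPosElem f → IsPosElem (φ₂ f)) ∧
      (∀ f g : C(Ω, ℂ), φ₂ (f * g) = φ₂ (g * f)) ∧
      (∀ x : ∀ i, A i, Φ x = φ₂ (φ₁ x)) ∧
      (Φ 1 = 1 → φ₁ 1 = 1 ∧ φ₂ 1 = 1) := by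
  have hcl : IsClosed (N.toStarSubalgebra : Set (H →L[ℂ] H)) := by
    rw [VonNeumannAlgebra.coe_toStarSubalgebra, ← N.centralizer_centralizer]
    exact Set.isClosed_centralizer _
  let _ : CStarAlgebra ↥N.toStarSubalgebra := StarSubalgebra.cstarAlgebra _ (h_closed := hcl)
  exact multi_main Φ hpos htr
end

section
/- Let Φ : 𝒜₁ ⊕ ⋯ ⊕ 𝒜_k → ℬ be a tracial positive multilinear map from a direct sum of unital C*-algebras into a von Neumann algebra ℬ. Then Φ is completely positive. Moreover, for every positive element 𝐏 of ⊕ᵢ₌₁ᵏ𝒜ᵢ, the induced multilinear map Ψ_𝐏 : ⊕ᵢ₌₁ᵏ𝒜ᵢ → ℬ defined by Ψ_𝐏(𝐀) = Φ(𝐏𝐀) is completely positive. -/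
/-- A (not necessarily linear) map `Φ : A → B` is `n`-positive if the entrywise induced map
on `n × n` matrices sends positive matrices to positive matrices. -/
def IsNPosMap {A B : Type*} [NonUnitalNonAssocSemiring A] [Star A]
    [NonUnitalNonAssocSemiring B] [Star B] (n : ℕ) (Φ : A → B) : Prop :=
  ∀ M : Matrix (Fin n) (Fin n) A, IsPosElem M → IsPosElem (M.map Φ)

section helpers
open scoped ComplexOrder

/-- scalar forms: positivity of the form gives a Gram factorisation -/
lemma scalar_psd_hermitian {n : ℕ} (M : Matrix (Fin n) (Fin n) ℂ)
    (h : ∀ c : Fin n → ℂ, 0 ≤ ∑ p, ∑ q, star (c p) * c q * M p q) : M.PosSemidef := by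
  have key : ∀ x : Fin n → ℂ, star x ⬝ᵥ (M.mulVec x) = ∑ p, ∑ q, star (x p) * x q * M p q := by
    intro x
    simp only [dotProduct, Matrix.mulVec, Finset.mul_sum, Pi.star_apply]
    refine Finset.sum_congr rfl fun p _ => Finset.sum_congr rfl fun q _ => by ring
  rw [Matrix.posSemidef_iff_dotProduct_mulVec]
  refine ⟨?_, fun x => by rw [key]; exact h x⟩
  rw [← Matrix.isSymmetric_toEuclideanLin_iff, LinearMap.isSymmetric_iff_inner_map_self_real]
  intro v
  have e : inner ℂ (Matrix.toEuclideanLin M v) v = star (star v.ofLp ⬝ᵥ (M.mulVec v.ofLp)) := by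
    rw [EuclideanSpace.inner_eq_star_dotProduct]
    simp only [Matrix.ofLp_toLpLin, Matrix.toLin'_apply, dotProduct, star_sum, star_mul', Pi.star_apply, star_star]
  rw [e, key]
  have := h v.ofLp
  simp only [starRingEnd_apply, star_star]
  exact (this.star_eq).symm

lemma sqrt_family {D X : Type*} [CStarAlgebra D] [PartialOrder D] [StarOrderedRing D]
    [TopologicalSpace X] (F : X → D) (hFc : Continuous F) (hF : ∀ x, 0 ≤ F x) :
    ∃ G : X → D, Continuous G ∧ ∀ x, F x = star (G x) * G x :=
  ⟨fun x => CFC.sqrt (F x), CFC.continuousOn_sqrt.comp_continuous hFc hF, fun x => by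
    rw [(CFC.sqrt_nonneg (F x)).isSelfAdjoint.star_eq, CFC.sqrt_mul_sqrt_self _ (hF x)]⟩

lemma comm_gram {n : ℕ} {C : Type*} [CommCStarAlgebra C] (T : Fin n → Fin n → C)
    (h : ∀ χ : WeakDual.characterSpace ℂ C, ∀ c : Fin n → ℂ,
      0 ≤ ∑ p, ∑ q, star (c p) * c q * χ (T p q)) :
    ∃ S : Fin n → Fin n → C, ∀ p q, T p q = ∑ r, star (S r p) * S r q := by
  let F : WeakDual.characterSpace ℂ C → CStarMatrix (Fin n) (Fin n) ℂ :=
    fun χ => CStarMatrix.ofMatrix (Matrix.of fun p q => χ (T p q))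
  have hF : ∀ χ, 0 ≤ F χ := by
    intro χ
    have := scalar_psd_hermitian (Matrix.of fun p q => χ (T p q)) (h χ)
    obtain ⟨B, hB⟩ := by
      open scoped MatrixOrder in
      exact (CStarAlgebra.nonneg_iff_eq_star_mul_self (a := Matrix.of fun p q => χ (T p q))).1 this.nonneg
    have : F χ = star (CStarMatrix.ofMatrix B) * (CStarMatrix.ofMatrix B) := by
      show CStarMatrix.ofMatrix _ = _
      rw [hB]; rfl
    rw [this]; exact star_mul_self_nonneg _
  have hFc : Continuous F := by
    refine continuous_pi fun p => continuous_pi fun q => ?_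
    exact (gelfandStarTransform C (T p q)).continuous
  obtain ⟨G, hSc, hG⟩ := sqrt_family F hFc hF
  let s : Fin n → Fin n → C(WeakDual.characterSpace ℂ C, ℂ) := fun r p =>
    ⟨fun χ => G χ r p, (continuous_apply p).comp ((continuous_apply r).comp hSc)⟩
  have hs : ∀ r p, gelfandStarTransform C ((gelfandStarTransform C).symm (s r p)) = s r p :=
    fun r p => (gelfandStarTransform C).apply_symm_apply _
  refine ⟨fun r p => (gelfandStarTransform C).symm (s r p), fun p q => ?_⟩
  have inj : Function.Injective (gelfandStarTransform C) := (gelfandStarTransform C).injective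
  apply inj
  rw [map_sum]
  simp only [map_mul, map_star, hs]
  ext χ
  have h2 := congrFun (congrFun (hG χ) p) q
  simp only [ContinuousMap.coe_sum, Finset.sum_apply, ContinuousMap.mul_apply,
    ContinuousMap.star_apply]
  rw [show (gelfandStarTransform C (T p q)) χ = F χ p q from rfl, h2, CStarMatrix.mul_apply]
  rfl

lemma comm_gram' {n : ℕ} {B : Type*} [CStarAlgebra B] [PartialOrder B] [StarOrderedRing B]
    (T : Fin n → Fin n → B)
    (hcomm : ∀ p q r s, T p q * T r s = T r s * T p q) (hstar : ∀ p q, star (T p q) = T q p)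
    (hpos : ∀ c : Fin n → ℂ, 0 ≤ ∑ p, ∑ q, (star (c p) * c q) • T p q) :
    ∃ S : Fin n → Fin n → B, ∀ p q, T p q = ∑ r, star (S r p) * S r q := by
  let s : Set B := Set.range fun x : Fin n × Fin n => T x.1 x.2
  have h1 : IsMulCommutative (StarAlgebra.adjoin ℂ s) := by
    apply StarAlgebra.isMulCommutative_adjoin
    · rintro _ ⟨x, rfl⟩ _ ⟨y, rfl⟩
      exact hcomm _ _ _ _
    · rintro _ ⟨x, rfl⟩ _ ⟨y, rfl⟩
      simp only [hstar]
      exact hcomm _ _ _ _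
  let C := (StarAlgebra.adjoin ℂ s).topologicalClosure
  have hC : IsClosed (C : Set B) := StarSubalgebra.isClosed_topologicalClosure _
  let i0 : CStarAlgebra C := StarSubalgebra.cstarAlgebra C
  let i1 : CommRing C := StarSubalgebra.commRingTopologicalClosure _ fun x y => mul_comm' x y
  let i2 : CommCStarAlgebra C := { i0 with mul_comm := i1.mul_comm }
  let T' : Fin n → Fin n → C := fun p q => ⟨T p q, StarSubalgebra.le_topologicalClosure _
    (StarAlgebra.subset_adjoin ℂ s ⟨(p, q), rfl⟩)⟩
  obtain ⟨S, hS⟩ := comm_gram (C := C) T' (by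
    intro χ c
    have e : ∑ p, ∑ q, star (c p) * c q * χ (T' p q)
        = χ (∑ p, ∑ q, (star (c p) * c q) • T' p q) := by
      simp only [map_sum, map_smul, smul_eq_mul]
    rw [e]
    have h2 : χ (∑ p, ∑ q, (star (c p) * c q) • T' p q) ∈
      spectrum ℂ (∑ p, ∑ q, (star (c p) * c q) • T' p q) := AlgHom.apply_mem_spectrum χ _
    have h3 := StarSubalgebra.mem_spectrum_iff (S := C) |>.1 h2
    refine spectrum_nonneg_of_nonneg ?_ h3
    have := hpos c
    convert this
    simp [T'])
  refine ⟨fun r p => S r p, fun p q => ?_⟩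
  have := congrArg (Subtype.val) (hS p q)
  simpa [T'] using this

section trace
open scoped InnerProductSpace
set_option linter.unusedSectionVars false
variable {A : Type*} [CStarAlgebra A] {E : Type*} [NormedAddCommGroup E] [InnerProductSpace ℂ E]
  [CompleteSpace E]

/-- operators on `E` whose matrix coefficients are given by a tracial functional -/
def IsZ (ι : A →ₗ[ℂ] E) (T : E →L[ℂ] E) : Prop :=
  ∃ σ : A → ℂ, (∀ a b, σ (a * b) = σ (b * a)) ∧ ∀ x y, ⟪ι x, T (ι y)⟫_ℂ = σ (star x * y)

variable {ι : A →ₗ[ℂ] E} {L : A → E →L[ℂ] E} {J : E → E} {T S : E →L[ℂ] E}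

lemma clm_mul (T S : E →L[ℂ] E) (v : E) : (T * S) v = T (S v) := rfl

lemma inner_L (hLs : ∀ a, star (L a) = L (star a)) (a : A) (u v : E) :
    ⟪u, L a v⟫_ℂ = ⟪L (star a) u, v⟫_ℂ := by
  rw [← ContinuousLinearMap.adjoint_inner_left, ← ContinuousLinearMap.star_eq_adjoint, hLs]

lemma clm_ext_dense (hd : DenseRange ι) (h : ∀ x y, ⟪ι x, T (ι y)⟫_ℂ = ⟪ι x, S (ι y)⟫_ℂ) :
    T = S := by
  have : ∀ u v, ⟪u, T v⟫_ℂ = ⟪u, S v⟫_ℂ := by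
    intro u v
    exact hd.induction_on₂ (p := fun u v => ⟪u, T v⟫_ℂ = ⟪u, S v⟫_ℂ)
      (isClosed_eq (by fun_prop) (by fun_prop)) h u v
  ext v
  exact ext_inner_left ℂ fun u => this u v

lemma IsZ.comm_L (hd : DenseRange ι) (hL : ∀ a b, L a (ι b) = ι (a * b))
    (hLs : ∀ a, star (L a) = L (star a)) (hT : IsZ ι T) (a : A) : T * L a = L a * T := by
  obtain ⟨σ, -, hσ⟩ := hT
  refine clm_ext_dense hd fun x y => ?_
  simp only [clm_mul]
  rw [hL, hσ, inner_L hLs, hL, hσ]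
  simp [mul_assoc]

lemma IsZ.J_eq (hd : DenseRange ι) (hJc : Continuous J) (hJ : ∀ a, J (ι a) = ι (star a))
    (hJi : ∀ x y, ⟪J x, J y⟫_ℂ = ⟪y, x⟫_ℂ) (hJJ : ∀ x, J (J x) = x) (hT : IsZ ι T) (v : E) :
    J (T v) = (star T) (J v) := by
  obtain ⟨σ, ht, hσ⟩ := hT
  refine hd.induction_on (p := fun v => J (T v) = (star T) (J v)) v
    (isClosed_eq (by fun_prop) (by fun_prop)) fun a => ?_
  refine ext_inner_left ℂ fun u => ?_
  refine hd.induction_on (p := fun u => ⟪u, J (T (ι a))⟫_ℂ = ⟪u, (star T) (J (ι a))⟫_ℂ) u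
    (isClosed_eq (by fun_prop) (by fun_prop)) fun x => ?_
  rw [ContinuousLinearMap.star_eq_adjoint, ContinuousLinearMap.adjoint_inner_right, hJ,
    ← hJJ (ι x), hJi, hJJ, hJ, ← inner_conj_symm, ← inner_conj_symm (T (ι x)), hσ, hσ, star_star,
    star_star, ht]

lemma IsZ.star' (hT : IsZ ι T) : IsZ ι (star T) := by
  obtain ⟨σ, ht, hσ⟩ := hT
  refine ⟨fun a => star (σ (star a)), fun a b => by simp only [star_mul]; rw [ht], fun x y => ?_⟩
  rw [ContinuousLinearMap.star_eq_adjoint, ContinuousLinearMap.adjoint_inner_right,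
    ← inner_conj_symm, hσ]
  simp

lemma IsZ.comm_R (hd : DenseRange ι) (hL : ∀ a b, L a (ι b) = ι (a * b))
    (hLs : ∀ a, star (L a) = L (star a)) (hJc : Continuous J) (hJ : ∀ a, J (ι a) = ι (star a))
    (hJi : ∀ x y, ⟪J x, J y⟫_ℂ = ⟪y, x⟫_ℂ) (hJJ : ∀ x, J (J x) = x) (hT : IsZ ι T) (a : A) (v : E) :
    T (J (L a (J v))) = J (L a (J (T v))) := by
  have h1 := hT.star'.comm_L hd hL hLs a
  have h2 := hT.star'.J_eq hd hJc hJ hJi hJJ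
  rw [star_star] at h2
  rw [← h2, hT.J_eq hd hJc hJ hJi hJJ]
  exact congrArg J (congrArg (fun f => f (J v)) h1)

lemma IsZ.mul (hd : DenseRange ι) (hL : ∀ a b, L a (ι b) = ι (a * b))
    (hLs : ∀ a, star (L a) = L (star a)) (hJc : Continuous J) (hJ : ∀ a, J (ι a) = ι (star a))
    (hJi : ∀ x y, ⟪J x, J y⟫_ℂ = ⟪y, x⟫_ℂ) (hJJ : ∀ x, J (J x) = x) (hT : IsZ ι T)
    (hS : IsZ ι S) : IsZ ι (T * S) := by
  have main : ∀ x y, ⟪ι x, (T * S) (ι y)⟫_ℂ = ⟪ι 1, (T * S) (ι (star x * y))⟫_ℂ := by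
    intro x y
    have hc : (T * S) * L (star x) = L (star x) * (T * S) := by
      rw [mul_assoc, hS.comm_L hd hL hLs, ← mul_assoc, hT.comm_L hd hL hLs, mul_assoc]
    have : (T * S) (ι (star x * y)) = L (star x) ((T * S) (ι y)) := by
      rw [← hL]
      exact congrArg (fun f => f (ι y)) hc
    rw [this, inner_L hLs, hL]
    simp
  refine ⟨fun a => ⟪ι 1, (T * S) (ι a)⟫_ℂ, fun a b => ?_, main⟩
  have e : ι (a * b) = J (L (star b) (J (ι a))) := by rw [hJ, hL, hJ]; simp
  have e2 : (T * S) (ι (a * b)) = J (L (star b) (J ((T * S) (ι a)))) := by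
    rw [e]
    simp only [clm_mul]
    rw [hS.comm_R hd hL hLs hJc hJ hJi hJJ, hT.comm_R hd hL hLs hJc hJ hJi hJJ]
  show ⟪ι 1, (T * S) (ι (a * b))⟫_ℂ = ⟪ι 1, (T * S) (ι (b * a))⟫_ℂ
  rw [e2]
  have m := main (star b) a
  rw [star_star] at m
  rw [← m, ← hJJ (ι 1), hJi, hJ, ← inner_conj_symm, inner_L hLs, hL, inner_conj_symm,
    ← hJJ (ι (star b)), hJ, ← hJi, hJJ]
  simp

lemma IsZ.commute (hd : DenseRange ι) (hL : ∀ a b, L a (ι b) = ι (a * b))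
    (hLs : ∀ a, star (L a) = L (star a)) (hJc : Continuous J) (hJ : ∀ a, J (ι a) = ι (star a))
    (hJi : ∀ x y, ⟪J x, J y⟫_ℂ = ⟪y, x⟫_ℂ) (hJJ : ∀ x, J (J x) = x) (hT : IsZ ι T)
    (hS : IsZ ι S) : T * S = S * T := by
  have h := (hT.mul hd hL hLs hJc hJ hJi hJJ hS).J_eq hd hJc hJ hJi hJJ
  have h' : star (T * S) = star T * star S := by
    ext v
    have := h (J v)
    rw [hJJ] at this
    rw [← this]
    simp only [clm_mul]
    rw [hT.J_eq hd hJc hJ hJi hJJ, hS.J_eq hd hJc hJ hJi hJJ, hJJ]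
  have := congrArg star h'
  simpa using this
end trace
set_option linter.unusedSimpArgs false

section gns
open scoped InnerProductSpace
open UniformSpace

lemma sum_two {n : ℕ} {B : Type*} [AddCommGroup B] [Module ℂ B] (N : Fin n → Fin n → B)
    (p q : Fin n) (β : ℂ) :
    ∑ p', ∑ q', (star ((Pi.single p 1 + β • Pi.single q 1 : Fin n → ℂ) p') *
        (Pi.single p 1 + β • Pi.single q 1 : Fin n → ℂ) q') • N p' q' =
        N p p + (star β * β) • N q q + β • N p q + star β • N q p := by
  have e : ∀ p', star ((Pi.single p 1 + β • Pi.single q 1 : Fin n → ℂ) p') =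
      (if p' = p then 1 else 0) + (if p' = q then star β else 0) := by
    intro p'
    simp only [Pi.add_apply, Pi.smul_apply, Pi.single_apply, star_add, smul_eq_mul]
    split_ifs <;> simp
  have e' : ∀ p', ((Pi.single p 1 + β • Pi.single q 1 : Fin n → ℂ) p') =
      (if p' = p then 1 else 0) + (if p' = q then β else 0) := by
    intro p'
    simp only [Pi.add_apply, Pi.smul_apply, Pi.single_apply, smul_eq_mul]
    split_ifs <;> simp
  have key : ∀ c d : Fin n → ℂ, ∑ p', ∑ q', (c p' * d q') • N p' q' =
      ∑ p', c p' • ∑ q', d q' • N p' q' := by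
    intro c d
    simp only [mul_smul, Finset.smul_sum]
  refine (key (fun p' => star ((Pi.single p 1 + β • Pi.single q 1 : Fin n → ℂ) p'))
    (fun p' => (Pi.single p 1 + β • Pi.single q 1 : Fin n → ℂ) p')).trans ?_
  simp only [e]
  simp only [e']
  simp only [mul_smul, add_smul, ite_smul, zero_smul, one_smul,
    Finset.sum_add_distrib, Finset.sum_ite_eq', Finset.mem_univ, if_true, smul_add]
  abel

lemma star_of_forms {n : ℕ} {B : Type*} [CStarAlgebra B] (T : Fin n → Fin n → B)
    (h : ∀ c : Fin n → ℂ, IsSelfAdjoint (∑ p, ∑ q, (star (c p) * c q) • T p q)) (p q : Fin n) :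
    star (T p q) = T q p := by
  have hd : ∀ p, IsSelfAdjoint (T p p) := by
    intro p
    have := h (Pi.single p 1 + (0 : ℂ) • Pi.single p 1)
    rw [sum_two] at this
    simpa using this
  have h1 := h (Pi.single p 1 + (1 : ℂ) • Pi.single q 1)
  have h2 := h (Pi.single p 1 + Complex.I • Pi.single q 1)
  rw [sum_two] at h1 h2
  have h1 := h1.star_eq
  have h2 := h2.star_eq
  simp only [star_add, star_neg, star_smul, (hd _).star_eq, star_one, one_smul, mul_one, star_star,
    Complex.star_def, Complex.conj_I, star_mul', map_mul, map_neg, neg_smul, neg_mul,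
    Complex.I_mul_I, neg_neg] at h1 h2
  have h1' : star (T p q) + star (T q p) = T p q + T q p := by
    have := sub_eq_zero.2 h1
    rw [← sub_eq_zero, ← this]; abel
  have h2' : Complex.I • (star (T q p) - star (T p q)) = Complex.I • (T p q - T q p) := by
    have := sub_eq_zero.2 h2
    rw [← sub_eq_zero, ← this, smul_sub, smul_sub]; abel
  have h3 := smul_right_injective B Complex.I_ne_zero h2'
  have h3 : star (T q p) - star (T p q) = T p q - T q p := h3
  have h4 : (2 : ℂ) • star (T p q) = (2 : ℂ) • T q p := by
    rw [two_smul, two_smul]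
    have := sub_eq_zero.2 h1'
    have h5 := sub_eq_zero.2 h3
    rw [← sub_eq_zero, ← sub_eq_zero.2 (this.trans h5.symm)]; abel
  exact smul_right_injective B (two_ne_zero' ℂ) h4

lemma exists_op {A : Type*} [CStarAlgebra A] [PartialOrder A] [StarOrderedRing A]
    (f σ : A →ₚ[ℂ] ℂ) (M : ℝ) (hM : 0 ≤ M)
    (h : ∀ a, σ (star a * a) ≤ M * f (star a * a)) :
    ∃ T : f.GNS →L[ℂ] f.GNS, ∀ x y : A,
      ⟪(f.toPreGNS x : f.GNS), T (f.toPreGNS y : f.GNS)⟫_ℂ = σ (star x * y) := by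
  let i : f.PreGNS →L[ℂ] σ.PreGNS :=
    (σ.toPreGNS.toLinearMap ∘ₗ f.ofPreGNS.toLinearMap).mkContinuous (√M) (by
      intro x
      rw [← sq_le_sq₀ (by positivity) (by positivity), mul_pow, Real.sq_sqrt hM,
        ← Complex.real_le_real]
      push_cast
      rw [PositiveLinearMap.preGNS_norm_sq, PositiveLinearMap.preGNS_norm_sq]
      exact h (f.ofPreGNS x))
  let I : f.GNS →L[ℂ] σ.GNS := i.completion
  refine ⟨(ContinuousLinearMap.adjoint I).comp I, fun x y => ?_⟩
  rw [ContinuousLinearMap.comp_apply, ContinuousLinearMap.adjoint_inner_right]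
  have e : ∀ z : A, I (f.toPreGNS z : f.GNS) = (σ.toPreGNS z : σ.GNS) := by
    intro z
    simp only [I, ContinuousLinearMap.completion_apply_coe]
    rfl
  rw [e, e, Completion.inner_coe, PositiveLinearMap.preGNS_inner_def]
  rfl

lemma exists_J {A : Type*} [CStarAlgebra A] [PartialOrder A] [StarOrderedRing A]
    (f : A →ₚ[ℂ] ℂ) (htr : ∀ a b, f (a * b) = f (b * a)) :
    ∃ J : f.GNS → f.GNS, Continuous J ∧
      (∀ a, J (f.toPreGNS a : f.GNS) = (f.toPreGNS (star a) : f.GNS)) ∧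
      (∀ x y, ⟪J x, J y⟫_ℂ = ⟪y, x⟫_ℂ) ∧ ∀ x, J (J x) = x := by
  let j : f.PreGNS → f.PreGNS := fun x => f.toPreGNS (star (f.ofPreGNS x))
  have hji : Isometry j := by
    refine Isometry.of_dist_eq fun x y => ?_
    have hn : ∀ x, ‖j x‖ = ‖x‖ := by
      intro x
      rw [PositiveLinearMap.preGNS_norm_def, PositiveLinearMap.preGNS_norm_def]
      simp only [j, PositiveLinearMap.ofPreGNS_toPreGNS, star_star]
      rw [htr]
    rw [dist_eq_norm, dist_eq_norm, ← hn (x - y)]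
    simp [j]
  have hc : Continuous (Completion.map j) := Completion.continuous_map
  have hj : ∀ x : f.PreGNS, Completion.map j (x : f.GNS) = (j x : f.GNS) := fun x =>
    Completion.map_coe hji.uniformContinuous x
  refine ⟨Completion.map j, hc, fun a => hj _, fun x y => ?_, fun x => ?_⟩
  · induction x, y using Completion.induction_on₂ with
    | hp => apply isClosed_eq <;> fun_prop
    | ih x y =>
      rw [hj, hj, Completion.inner_coe, Completion.inner_coe, PositiveLinearMap.preGNS_inner_def,
        PositiveLinearMap.preGNS_inner_def]
      simp only [j, PositiveLinearMap.ofPreGNS_toPreGNS, star_star]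
      rw [htr]
  · induction x using Completion.induction_on with
    | hp => apply isClosed_eq <;> fun_prop
    | ih x => rw [hj, hj]; simp [j]

lemma trace_form {A : Type*} [CStarAlgebra A] {n : ℕ} (τ : Fin n → Fin n → A →ₗ[ℂ] ℂ)
    (htr : ∀ p q a b, τ p q (a * b) = τ p q (b * a))
    (hpos : ∀ (a : A) (c : Fin n → ℂ), 0 ≤ ∑ p, ∑ q, star (c p) * c q * τ p q (star a * a))
    (y : Fin n → A) : 0 ≤ ∑ p, ∑ q, τ p q (star (y p) * y q) := by
  let _ : PartialOrder A := CStarAlgebra.spectralOrder A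
  have : StarOrderedRing A := CStarAlgebra.spectralOrderedRing A
  have hdiag : ∀ p a, 0 ≤ τ p p (star a * a) := by
    intro p a
    have := hpos a (Pi.single p 1)
    simpa [Pi.single_apply] using this
  let mk : (σ : A →ₗ[ℂ] ℂ) → (∀ a, 0 ≤ σ (star a * a)) → A →ₚ[ℂ] ℂ := fun σ h =>
    PositiveLinearMap.mk₀ σ (fun x hx => by
      obtain ⟨b, rfl⟩ := CStarAlgebra.nonneg_iff_eq_star_mul_self.1 hx
      exact h b)
  let f : A →ₚ[ℂ] ℂ := mk (∑ p, τ p p) (fun a => by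
    rw [LinearMap.sum_apply]; exact Finset.sum_nonneg fun p _ => hdiag p a)
  have hf : ∀ a, f a = ∑ p, τ p p a := fun a => LinearMap.sum_apply _ _ _
  have hftr : ∀ a b, f (a * b) = f (b * a) := fun a b => by
    rw [hf, hf]; exact Finset.sum_congr rfl fun p _ => htr p p a b
  have hle : ∀ p a, τ p p (star a * a) ≤ f (star a * a) := by
    intro p a
    rw [hf]
    exact Finset.single_le_sum (f := fun p => τ p p (star a * a)) (fun q _ => hdiag q a)
      (Finset.mem_univ p)
  obtain ⟨J, hJc, hJ, hJi, hJJ⟩ := exists_J f hftr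
  let ι : A →ₗ[ℂ] f.GNS :=
    (Completion.toComplL (𝕜 := ℂ) (E := f.PreGNS)).toLinearMap ∘ₗ f.toPreGNS.toLinearMap
  have hd : DenseRange ι := by
    have h1 : DenseRange ((↑) : f.PreGNS → f.GNS) := Completion.denseRange_coe
    exact h1.comp f.toPreGNS.surjective.denseRange (Completion.continuous_coe _)
  let L : A → f.GNS →L[ℂ] f.GNS := fun a => f.gnsStarAlgHom a
  have hL : ∀ a b, L a (ι b) = ι (a * b) := by
    intro a b
    exact f.gnsNonUnitalStarAlgHom_apply_coe
  have hLs : ∀ a, star (L a) = L (star a) := fun a => (map_star f.gnsStarAlgHom a).symm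
  -- the polarised functionals
  have hq : ∀ (p q : Fin n) (β : ℂ), star β * β = 1 → ∀ a,
      0 ≤ τ p p (star a * a) + τ q q (star a * a) + β * τ p q (star a * a)
        + star β * τ q p (star a * a) := by
    intro p q β hβ a
    have := hpos a (Pi.single p 1 + β • Pi.single q 1)
    have e := sum_two (fun p q => τ p q (star a * a)) p q β
    simp only [smul_eq_mul] at e
    rw [e, hβ, one_mul] at this
    exact this
  have hop1 : ∀ (p q : Fin n) (β : ℂ), star β * β = 1 → ∃ T : f.GNS →L[ℂ] f.GNS, ∀ x y,
      ⟪ι x, T (ι y)⟫_ℂ = τ p p (star x * y) + τ q q (star x * y) + β * τ p q (star x * y)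
        + star β * τ q p (star x * y) := by
    intro p q β hβ
    let σ : A →ₚ[ℂ] ℂ := mk (τ p p + τ q q + β • τ p q + star β • τ q p) (hq p q β hβ)
    obtain ⟨T, hT⟩ := exists_op f σ 4 (by norm_num) (by
      intro a
      have h1 := hq p q (-β) (by simpa using hβ) a
      have h2 := hle p a
      have h3 := hle q a
      have e : σ (star a * a) = τ p p (star a * a) + τ q q (star a * a) + β * τ p q (star a * a)
        + star β * τ q p (star a * a) := rfl
      rw [e]
      rw [← sub_nonneg] at h2 h3 ⊢
      have := add_nonneg h1 (add_nonneg (add_nonneg h2 h2) (add_nonneg h3 h3))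
      convert this using 1
      simp only [star_neg]
      push_cast
      ring)
    exact ⟨T, hT⟩
  have hop : ∀ p q : Fin n, ∃ T : f.GNS →L[ℂ] f.GNS, ∀ x y,
      ⟪ι x, T (ι y)⟫_ℂ = τ p q (star x * y) := by
    intro p q
    obtain ⟨T1, h1⟩ := hop1 p q 1 (by simp)
    obtain ⟨T2, h2⟩ := hop1 p q (-1) (by simp)
    obtain ⟨T3, h3⟩ := hop1 p q Complex.I (by simp)
    obtain ⟨T4, h4⟩ := hop1 p q (-Complex.I) (by simp)
    refine ⟨(1 / 4 : ℂ) • (T1 - T2 - Complex.I • T3 + Complex.I • T4), fun x y => ?_⟩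
    simp only [smul_apply, add_apply,
      sub_apply, inner_smul_right, inner_add_right, inner_sub_right,
      h1, h2, h3, h4, star_neg, star_one, Complex.star_def, Complex.conj_I]
    linear_combination (-1 / 2 * τ p q (star x * y) + 1 / 2 * τ q p (star x * y)) * Complex.I_sq
  choose T hT using hop
  have hZ : ∀ p q, IsZ ι (T p q) := fun p q => ⟨τ p q, htr p q, hT p q⟩
  have hcomb : ∀ (c : Fin n → ℂ) (x y : A),
      ⟪ι x, (∑ p, ∑ q, (star (c p) * c q) • T p q) (ι y)⟫_ℂ
        = ∑ p, ∑ q, star (c p) * c q * τ p q (star x * y) := by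
    intro c x y
    simp only [sum_apply, smul_apply, inner_sum,
      inner_smul_right, hT]
  have hposT : ∀ c : Fin n → ℂ, 0 ≤ ∑ p, ∑ q, (star (c p) * c q) • T p q := by
    intro c
    set P := ∑ p, ∑ q, (star (c p) * c q) • T p q with hP
    have h1 : ∀ v, 0 ≤ ⟪v, P v⟫_ℂ := by
      intro v
      refine hd.induction_on (p := fun v => 0 ≤ ⟪v, P v⟫_ℂ) v
        (isClosed_Ici.preimage (f := fun v => ⟪v, P v⟫_ℂ) (by fun_prop)) fun a => ?_
      rw [hP, hcomb]
      exact hpos a c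
    rw [ContinuousLinearMap.nonneg_iff_isPositive, ContinuousLinearMap.isPositive_iff_complex]
    intro v
    have h2 : 0 ≤ ⟪P v, v⟫_ℂ := by
      rw [← inner_conj_symm]
      have := star_nonneg_iff.2 (h1 v)
      exact this
    exact ⟨(Complex.eq_re_of_ofReal_le h2).symm, (Complex.nonneg_iff.1 h2).1⟩
  have hstarT : ∀ p q, star (T p q) = T q p := star_of_forms T fun c => (hposT c).isSelfAdjoint
  obtain ⟨S, hS⟩ := comm_gram' T
    (fun p q r s => (hZ p q).commute hd hL hLs hJc hJ hJi hJJ (hZ r s)) hstarT hposT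
  have e : ∑ p, ∑ q, τ p q (star (y p) * y q) =
      ∑ r, ⟪∑ p, S r p (ι (y p)), ∑ q, S r q (ι (y q))⟫_ℂ := by
    simp only [← hT, hS, inner_sum, sum_inner, sum_apply, clm_mul,
      ContinuousLinearMap.star_eq_adjoint, ContinuousLinearMap.adjoint_inner_right]
    rw [Finset.sum_comm]
    rw [eq_comm, Finset.sum_comm]
    refine Finset.sum_congr rfl fun q _ => ?_
    rw [Finset.sum_comm]
  rw [e]
  refine Finset.sum_nonneg fun r _ => ?_
  rw [inner_self_eq_norm_sq_to_K]
  exact pow_nonneg (Complex.zero_le_real.2 (norm_nonneg (∑ p, S r p (ι (y p))))) 2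
end gns
section final
open scoped InnerProductSpace

lemma multi_form {k : ℕ} {A : Fin k → Type*} [∀ i, CStarAlgebra (A i)]
    {H : Type*} [NormedAddCommGroup H] [InnerProductSpace ℂ H] [CompleteSpace H]
    (Φ : MultilinearMap ℂ A (H →L[ℂ] H))
    (hpos : ∀ x : ∀ i, A i, (∀ i, IsPosElem (x i)) → IsPosElem (Φ x))
    (htr : ∀ a b : ∀ i, A i, Φ (a * b) = Φ (b * a)) {n : ℕ} (Y : Fin n → ∀ i, A i)
    (S : Finset (Fin k)) : ∀ (z : ∀ i, A i), (∀ i, IsPosElem (z i)) → ∀ h : Fin n → H,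
      0 ≤ ∑ p, ∑ q, ⟪h p, Φ (fun i => if i ∈ S then star (Y p i) * Y q i else z i) (h q)⟫_ℂ := by
  induction S using Finset.induction_on with
  | empty =>
    intro z hz h
    obtain ⟨b, hb⟩ := hpos z hz
    simp only [Finset.notMem_empty, if_false]
    have e : ∑ p, ∑ q, ⟪h p, Φ z (h q)⟫_ℂ = ⟪∑ p, b (h p), ∑ q, b (h q)⟫_ℂ := by
      simp only [sum_inner, inner_sum]
      rw [Finset.sum_comm]
      refine Finset.sum_congr rfl fun q _ => Finset.sum_congr rfl fun p _ => ?_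
      rw [hb, clm_mul, ContinuousLinearMap.star_eq_adjoint,
        ContinuousLinearMap.adjoint_inner_right]
    change 0 ≤ ∑ p, ∑ q, ⟪h p, Φ z (h q)⟫_ℂ
    rw [e, inner_self_eq_norm_sq_to_K]
    exact pow_nonneg (Complex.zero_le_real.2 (norm_nonneg (∑ p, b (h p)))) 2
  | insert j S hj ih =>
    intro z hz h
    let g : Fin n → Fin n → ∀ i, A i := fun p q i =>
      if i ∈ S then star (Y p i) * Y q i else z i
    let τ : Fin n → Fin n → A j →ₗ[ℂ] ℂ := fun p q =>
      (innerSL ℂ (h p)).toLinearMap ∘ₗ (ContinuousLinearMap.apply ℂ H (h q)).toLinearMap ∘ₗ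
        Φ.toLinearMap (g p q) j
    have hτ : ∀ p q a, τ p q a = ⟪h p, Φ (Function.update (g p q) j a) (h q)⟫_ℂ :=
      fun p q a => rfl
    have hu : ∀ p q a, Function.update (g p q) j a =
        fun i => if i ∈ S then star (Y p i) * Y q i else Function.update z j a i := by
      intro p q a
      funext i
      by_cases hi : i = j
      · subst hi; simp [hj]
      · simp [g, Function.update_of_ne hi]
    have htr' : ∀ (w : ∀ i, A i) (a b : A j), Φ (Function.update w j (a * b)) =
        Φ (Function.update w j (b * a)) := by
      intro w a b
      have e1 : Function.update w j (a * b) =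
          Function.update w j a * Function.update (1 : ∀ i, A i) j b := by
        rw [← Function.update_mul, mul_one]
      have e2 : Function.update w j (b * a) =
          Function.update (1 : ∀ i, A i) j b * Function.update w j a := by
        rw [← Function.update_mul, one_mul]
      rw [e1, e2, htr]
    have key := trace_form τ (fun p q a b => by rw [hτ, hτ, htr']) (by
      intro a c
      have hz' : ∀ i, IsPosElem (Function.update z j (star a * a) i) := by
        intro i
        by_cases hi : i = j
        · subst hi; exact ⟨a, by simp⟩
        · rw [Function.update_of_ne hi]; exact hz i
      have := ih _ hz' (fun p => c p • h p)
      simp only [← hu, map_smul, inner_smul_left, inner_smul_right] at this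
      simp only [hτ]
      refine this.trans_eq (Finset.sum_congr rfl fun p _ => Finset.sum_congr rfl fun q _ => ?_)
      simp only [Complex.star_def]
      ring) (fun p => Y p j)
    have e : ∀ p q, (fun i => if i ∈ insert j S then star (Y p i) * Y q i else z i) =
        Function.update (g p q) j (star (Y p j) * Y q j) := by
      intro p q
      funext i
      by_cases hi : i = j
      · subst hi; simp
      · simp [g, Function.update_of_ne hi, hi]
    simp only [e, ← hτ]
    exact key

lemma matrix_form {k : ℕ} {A : Fin k → Type*} [∀ i, CStarAlgebra (A i)]
    {H : Type*} [NormedAddCommGroup H] [InnerProductSpace ℂ H] [CompleteSpace H]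
    (Φ : MultilinearMap ℂ A (H →L[ℂ] H))
    (hpos : ∀ x : ∀ i, A i, (∀ i, IsPosElem (x i)) → IsPosElem (Φ x))
    (htr : ∀ a b : ∀ i, A i, Φ (a * b) = Φ (b * a)) {n : ℕ}
    (M : Matrix (Fin n) (Fin n) (∀ i, A i)) (hM : IsPosElem M) (h : Fin n → H) :
    0 ≤ ∑ p, ∑ q, ⟪h p, Φ (M p q) (h q)⟫_ℂ := by
  obtain ⟨X, rfl⟩ := hM
  have e : ∀ p q, Φ ((star X * X) p q) =
      ∑ ρ : Fin k → Fin n, Φ (fun i => star (X (ρ i) p i) * X (ρ i) q i) := by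
    intro p q
    rw [← MultilinearMap.map_sum (f := Φ) (g := fun i r => star (X r p i) * X r q i)]
    congr 1
    funext i
    simp [Matrix.mul_apply, Matrix.star_apply]
  have e2 : ∑ p, ∑ q, ⟪h p, Φ ((star X * X) p q) (h q)⟫_ℂ =
      ∑ ρ : Fin k → Fin n, ∑ p, ∑ q,
        ⟪h p, Φ (fun i => star (X (ρ i) p i) * X (ρ i) q i) (h q)⟫_ℂ := by
    simp only [e, sum_apply, inner_sum]
    rw [eq_comm, Finset.sum_comm]
    refine Finset.sum_congr rfl fun p _ => ?_
    rw [Finset.sum_comm]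
  rw [e2]
  refine Finset.sum_nonneg fun ρ _ => ?_
  have := multi_form Φ hpos htr (fun p i => X (ρ i) p i) Finset.univ (fun i => 0)
    (fun i => ⟨0, by simp⟩) h
  simpa only [Finset.mem_univ, if_true] using this

lemma pos_of_compress {D : Type*} [CStarAlgebra D] (a : D) (ha : IsSelfAdjoint a)
    (h : ∀ d e : D, star d * a * d = -(star e * e) → e = 0) : ∃ b, a = star b * b := by
  let _ : PartialOrder D := CStarAlgebra.spectralOrder D
  have : StarOrderedRing D := CStarAlgebra.spectralOrderedRing D
  have hn : 0 ≤ a⁻ := CFC.negPart_nonneg a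
  obtain ⟨s, hs⟩ := CStarAlgebra.nonneg_iff_eq_star_mul_self.1 hn
  have hsa : star a⁻ = a⁻ := hn.isSelfAdjoint.star_eq
  have hdec : a = a⁺ - a⁻ := (CFC.posPart_sub_negPart a ha).symm
  have h0 : a⁻ * a⁺ = 0 := CFC.negPart_mul_posPart a
  have e0 : s * a⁻ = 0 := by
    refine h a⁻ _ ?_
    rw [hsa, star_mul, hsa]
    have : a⁻ * a = - (a⁻ * a⁻) := by
      calc a⁻ * a = a⁻ * (a⁺ - a⁻) := congrArg (a⁻ * ·) hdec
        _ = - (a⁻ * a⁻) := by rw [mul_sub, h0, zero_sub]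
    rw [this]
    have e2 : a⁻ * star s * (s * a⁻) = a⁻ * (star s * s) * a⁻ := by simp only [mul_assoc]
    rw [e2, ← hs, neg_mul]
  have e1 : star a⁻ * a⁻ = 0 := by
    rw [hsa]
    nth_rw 1 [hs]
    rw [mul_assoc, e0, mul_zero]
  have e2 : a⁻ = 0 := CStarRing.star_mul_self_eq_zero_iff _ |>.1 e1
  have : 0 ≤ a := by
    have hp : 0 ≤ a⁺ := CFC.posPart_nonneg a
    have : a = a⁺ := by
      calc a = a⁺ - a⁻ := hdec
        _ = a⁺ := by rw [e2, sub_zero]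
    exact hp.trans_eq this.symm
  exact CStarAlgebra.nonneg_iff_eq_star_mul_self.1 this

lemma matrix_pos {n : ℕ} {B : Type*} [CStarAlgebra B] (K : Matrix (Fin n) (Fin n) B)
    (hs : star K = K)
    (main : ∀ d e : Matrix (Fin n) (Fin n) B, star d * K * d = -(star e * e) → e = 0) :
    IsPosElem K := by
  let _ : PartialOrder B := CStarAlgebra.spectralOrder B
  have : StarOrderedRing B := CStarAlgebra.spectralOrderedRing B
  obtain ⟨b, hb⟩ := pos_of_compress (D := CStarMatrix (Fin n) (Fin n) B)
    (CStarMatrix.ofMatrix K) hs (fun d e hde => main d e hde)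
  exact ⟨b, hb⟩

lemma pos_of_forms {n : ℕ}
    {H : Type*} [NormedAddCommGroup H] [InnerProductSpace ℂ H] [CompleteSpace H]
    (N : VonNeumannAlgebra H) (K : Matrix (Fin n) (Fin n) ↥N.toStarSubalgebra)
    (hK : ∀ h : Fin n → H, 0 ≤ ∑ p, ∑ q, ⟪h p, (K p q : H →L[ℂ] H) (h q)⟫_ℂ) :
    IsPosElem K := by
  have hcl : IsClosed (N.toStarSubalgebra : Set (H →L[ℂ] H)) := by
    rw [VonNeumannAlgebra.coe_toStarSubalgebra, ← N.centralizer_centralizer]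
    exact Set.isClosed_centralizer _
  have hstar : ∀ p q, star (K p q) = K q p := by
    intro p q
    apply Subtype.ext
    refine star_of_forms (fun p q => (K p q : H →L[ℂ] H)) (fun c => ?_) p q
    refine IsSelfAdjoint.of_nonneg ?_
    rw [ContinuousLinearMap.nonneg_iff_isPositive, ContinuousLinearMap.isPositive_iff_complex]
    intro v
    set P := ∑ p, ∑ q, (star (c p) * c q) • (K p q : H →L[ℂ] H) with hP
    have h1 : 0 ≤ ⟪v, P v⟫_ℂ := by
      have := hK (fun p => c p • v)
      convert this using 1
      simp only [hP, sum_apply, smul_apply, inner_sum, inner_smul_right, map_smul, inner_smul_left]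
      refine Finset.sum_congr rfl fun p _ => Finset.sum_congr rfl fun q _ => ?_
      simp only [Complex.star_def]
      ring
    have h2 : 0 ≤ ⟪P v, v⟫_ℂ := by
      rw [← inner_conj_symm]
      exact star_nonneg_iff.2 h1
    exact ⟨(Complex.eq_re_of_ofReal_le h2).symm, (Complex.nonneg_iff.1 h2).1⟩
  let act : Matrix (Fin n) (Fin n) ↥N.toStarSubalgebra → (Fin n → H) → Fin n → H :=
    fun K v p => ∑ q, (K p q : H →L[ℂ] H) (v q)
  have hact : ∀ K L v, act (K * L) v = act K (act L v) := by
    intro K L v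
    funext p
    simp only [act, Matrix.mul_apply, AddSubmonoidClass.coe_finsetSum, MulMemClass.coe_mul,
      sum_apply, clm_mul, map_sum]
    rw [Finset.sum_comm]
  have hadj : ∀ K v w, ∑ p, ⟪v p, act (star K) w p⟫_ℂ = ∑ p, ⟪act K v p, w p⟫_ℂ := by
    intro K v w
    simp only [act, inner_sum, sum_inner, Matrix.star_apply]
    rw [Finset.sum_comm]
    refine Finset.sum_congr rfl fun p _ => Finset.sum_congr rfl fun q _ => ?_
    rw [StarMemClass.coe_star, ContinuousLinearMap.star_eq_adjoint,
      ContinuousLinearMap.adjoint_inner_right]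
  have hK' : ∀ h, 0 ≤ ∑ p, ⟪h p, act K h p⟫_ℂ := by
    intro h
    simp only [act, inner_sum]
    exact hK h
  have main : ∀ d e : Matrix (Fin n) (Fin n) ↥N.toStarSubalgebra,
      star d * K * d = -(star e * e) → e = 0 := by
    intro d e hde
    have h0 : ∀ v p, act e v p = 0 := by
      intro v
      have h1 := hK' (act d v)
      rw [← hadj, ← hact, ← hact, hde] at h1
      have h2 : ∑ p, ⟪v p, act (-(star e * e)) v p⟫_ℂ = -∑ p, ⟪act e v p, act e v p⟫_ℂ := by
        rw [← hadj, ← hact]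
        simp [act, inner_sum]
      rw [h2] at h1
      have h3 : ∀ p ∈ Finset.univ, (0 : ℝ) ≤ ‖act e v p‖ ^ 2 := fun p _ => sq_nonneg _
      have h4 : ∑ p, ‖act e v p‖ ^ 2 ≤ 0 := by
        have : ∑ p, ⟪act e v p, act e v p⟫_ℂ = ((∑ p, ‖act e v p‖ ^ 2 : ℝ) : ℂ) := by
          push_cast
          refine Finset.sum_congr rfl fun p _ => ?_
          exact inner_self_eq_norm_sq_to_K _
        rw [this, ← Complex.ofReal_neg, Complex.zero_le_real] at h1
        linarith
      have h5 := (Finset.sum_eq_zero_iff_of_nonneg h3).1 (le_antisymm h4 (Finset.sum_nonneg h3))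
      intro p
      simpa using h5 p (Finset.mem_univ p)
    ext p q x
    have := h0 (Pi.single q x) p
    simp only [act] at this
    rw [Finset.sum_eq_single q] at this
    · simpa using this
    · intro r _ hr
      simp [Pi.single_eq_of_ne hr]
    · simp
  let _ : CStarAlgebra ↥N.toStarSubalgebra :=
    StarSubalgebra.cstarAlgebra N.toStarSubalgebra (h_closed := hcl)
  exact matrix_pos K (Matrix.ext fun p q => hstar q p) main

lemma first_part {k : ℕ} {A : Fin k → Type*} [∀ i, CStarAlgebra (A i)]
    {H : Type*} [NormedAddCommGroup H] [InnerProductSpace ℂ H] [CompleteSpace H]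
    (N : VonNeumannAlgebra H)
    (Φ : MultilinearMap ℂ A ↥N.toStarSubalgebra)
    (hpos : ∀ x : ∀ i, A i, (∀ i, IsPosElem (x i)) → IsPosElem (Φ x))
    (htr : ∀ a b : ∀ i, A i, Φ (a * b) = Φ (b * a)) (n : ℕ) : IsNPosMap n ⇑Φ := by
  intro M hM
  refine pos_of_forms N _ fun h => ?_
  exact matrix_form (N.toStarSubalgebra.subtype.toAlgHom.toLinearMap.compMultilinearMap Φ)
    (fun x hx => by
      obtain ⟨b, hb⟩ := hpos x hx
      exact ⟨b, congrArg Subtype.val hb⟩)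
    (fun a b => congrArg Subtype.val (htr a b)) M hM h

lemma second_part {k : ℕ} {A : Fin k → Type*} [∀ i, CStarAlgebra (A i)]
    {H : Type*} [NormedAddCommGroup H] [InnerProductSpace ℂ H] [CompleteSpace H]
    (N : VonNeumannAlgebra H)
    (Φ : MultilinearMap ℂ A ↥N.toStarSubalgebra)
    (hpos : ∀ x : ∀ i, A i, (∀ i, IsPosElem (x i)) → IsPosElem (Φ x))
    (htr : ∀ a b : ∀ i, A i, Φ (a * b) = Φ (b * a)) (P : ∀ i, A i) (hP : IsPosElem P) (n : ℕ) :
    IsNPosMap n (fun a : ∀ i, A i => Φ (P * a)) := by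
  obtain ⟨Q, rfl⟩ := hP
  rintro _ ⟨X, rfl⟩
  have key := first_part N Φ hpos htr n (M := (star X * X).map fun a => Q * a * star Q)
    ⟨X.map fun a => a * star Q, by
      ext p q : 2
      simp only [Matrix.map_apply, Matrix.mul_apply, Matrix.star_apply, star_mul, star_star,
        Finset.mul_sum, Finset.sum_mul, mul_assoc]⟩
  convert key using 1
  ext p q : 2
  simp only [Matrix.map_apply]
  rw [mul_assoc, htr]
end final
end helpers

/-- Corollary 3.8 (for a von Neumann algebra codomain): every tracial positive multilinear
map `Φ : 𝒜₁ ⊕ ⋯ ⊕ 𝒜_k → ℬ` into a von Neumann algebra is completely positive; moreover,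
for every positive `𝐏` the induced multilinear map `Ψ_𝐏(𝐀) = Φ(𝐏𝐀)` is completely
positive. -/
theorem tracial_positive_multilinear_completely_positive
    {k : ℕ} {A : Fin k → Type*} [∀ i, CStarAlgebra (A i)]
    {H : Type*} [NormedAddCommGroup H] [InnerProductSpace ℂ H] [CompleteSpace H]
    (N : VonNeumannAlgebra H)
    (Φ : MultilinearMap ℂ A ↥N.toStarSubalgebra)
    (hpos : ∀ x : ∀ i, A i, (∀ i, IsPosElem (x i)) → IsPosElem (Φ x))
    (htr : ∀ a b : ∀ i, A i, Φ (a * b) = Φ (b * a)) :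
    (∀ n : ℕ, IsNPosMap n ⇑Φ) ∧
      ∀ P : ∀ i, A i, IsPosElem P →
        ∀ n : ℕ, IsNPosMap n (fun a : ∀ i, A i => Φ (P * a)) := by
  exact ⟨first_part N Φ hpos htr, second_part N Φ hpos htr⟩
end

section
/- Let Φ : 𝒜 → ℬ be a unital positive linear map from a unital C*-algebra 𝒜 into a commutative unital C*-algebra ℬ. Then for all self-adjoint elements A, B ∈ 𝒜 the Schrödinger-type uncertainty relation Var_Φ(A)·Var_Φ(B) ≥ |Re Cov_Φ(A,B)|² + (1/4)|Φ(AB − BA)|² holds. -/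
open scoped ComplexOrder in
lemma complex_star_mul_self_nonneg (z : ℂ) : 0 ≤ star z * z := star_mul_self_nonneg z

open scoped ComplexOrder in
lemma isPosElem_of_characters {ℬ : Type*} [CommCStarAlgebra ℬ] (x : ℬ)
    (h : ∀ χ : WeakDual.characterSpace ℂ ℬ, 0 ≤ χ x) : IsPosElem x := by
  let g : C(WeakDual.characterSpace ℂ ℬ, ℂ) :=
    ⟨fun χ => ((Real.sqrt (gelfandStarTransform ℬ x χ).re : ℝ) : ℂ), by fun_prop⟩
  refine ⟨(gelfandStarTransform ℬ).symm g, ?_⟩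
  apply EquivLike.injective (gelfandStarTransform ℬ)
  rw [map_mul, map_star, StarAlgEquiv.apply_symm_apply]
  ext χ
  have hx : 0 ≤ gelfandStarTransform ℬ x χ := h χ
  obtain ⟨h1, h2⟩ := Complex.nonneg_iff.mp hx
  simp only [ContinuousMap.mul_apply, ContinuousMap.star_apply, g, ContinuousMap.coe_mk,
    Complex.star_def, Complex.conj_ofReal]
  rw [← Complex.ofReal_mul, Real.mul_self_sqrt h1]
  apply Complex.ext
  · simp
  · rw [← h2, Complex.ofReal_im]

open scoped ComplexOrder in
lemma state_schrodinger {𝒜 : Type*} [CStarAlgebra 𝒜] (f : 𝒜 →ₗ[ℂ] ℂ) (h1 : f 1 = 1)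
    (hf : ∀ a, 0 ≤ f (star a * a)) (A B : 𝒜) (hA : star A = A) (hB : star B = B) :
    0 ≤ (f (A * A) - f A * f A) * (f (B * B) - f B * f B) -
      (star ((1 / 2 : ℂ) * ((f (A * B) - f A * f B) + star (f (A * B) - f A * f B))) *
          ((1 / 2 : ℂ) * ((f (A * B) - f A * f B) + star (f (A * B) - f A * f B))) +
        (1 / 4 : ℂ) * (star (f (A * B - B * A)) * f (A * B - B * A))) := by
  have key : ∀ c d : ℂ, 0 ≤ f (A * A) + c * f (A * B) + d * f A + star c * f (B * A)
      + star c * c * f (B * B) + star c * d * f B + star d * f A + star d * c * f B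
      + star d * d := by
    intro c d
    have := hf (A + c • B + d • 1)
    simp only [star_add, star_smul, hA, hB, star_one, mul_add, add_mul, smul_mul_assoc,
      mul_smul_comm, mul_one, one_mul, map_add, map_smul, smul_eq_mul, h1] at this
    convert this using 1
    ring
  have hBB := hf B
  rw [hB] at hBB
  rw [map_sub]
  generalize f (A * A) = p at *
  generalize f (B * B) = q at *
  generalize f (A * B) = r at *
  generalize f (B * A) = s at *
  generalize f A = a at *
  generalize f B = b at *
  obtain ⟨p, p'⟩ := p
  obtain ⟨q, q'⟩ := q
  obtain ⟨r, r'⟩ := r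
  obtain ⟨s, s'⟩ := s
  obtain ⟨a, a'⟩ := a
  obtain ⟨b, b'⟩ := b
  have key2 : ∀ x y z w : ℝ, _ := fun x y z w => Complex.nonneg_iff.mp (key ⟨x, y⟩ ⟨z, w⟩)
  obtain ⟨hq, hq'⟩ := Complex.nonneg_iff.mp hBB
  simp [Complex.add_re, Complex.add_im, Complex.mul_re, Complex.mul_im] at key2 hq hq'
  subst hq'
  have e1 := (key2 0 0 0 0).2
  have e2 := (key2 0 0 1 0).2
  have e3 := (key2 1 0 0 0).2
  have e4 := (key2 0 1 0 0).2
  have e5 := (key2 1 0 1 0).2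
  simp at e1 e2 e3 e4 e5
  have hp' : p' = 0 := by linarith
  have ha' : a' = 0 := by linarith
  have hs' : s' = - r' := by linarith
  have hs : s = r := by linarith
  have hb' : b' = 0 := by linarith
  subst hp' ha' hs' hs hb'
  have main : ∀ x y : ℝ, 0 ≤ (p - a * a) + 2 * (x * (s - a * b) - y * r')
      + (x * x + y * y) * (q - b * b) := by
    intro x y
    have := (key2 x y (-a - x * b) (-(y * b))).1
    nlinarith [this]
  rw [Complex.nonneg_iff]
  simp [Complex.add_re, Complex.add_im, Complex.mul_re, Complex.mul_im]
  have hd := discrim_le_zero (a := ((s - a * b)^2 + r'^2) * (q - b * b))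
    (b := - 2 * ((s - a * b)^2 + r'^2)) (c := p - a * a) (by
      intro t
      have := main (- t * (s - a * b)) (t * r')
      nlinarith [this])
  unfold discrim at hd
  have hfin : (s - a * b)^2 + r'^2 ≤ (p - a * a) * (q - b * b) := by
    rcases (by positivity : 0 ≤ (s - a * b)^2 + r'^2).eq_or_lt with h0 | h0
    · rw [← h0]
      have hP : 0 ≤ p - a * a := by simpa using main 0 0
      have hQ : 0 ≤ q - b * b := by
        by_contra hneg
        push Not at hneg
        have u : s - a * b = 0 := by nlinarith [sq_nonneg (s - a * b), sq_nonneg r']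
        have v : r' = 0 := by nlinarith [sq_nonneg (s - a * b), sq_nonneg r']
        have := main ((p - a * a + 1) / (-(q - b * b)) + 1) 0
        rw [u, v] at this
        set P := p - a * a
        set Q := q - b * b
        have hk : (P + 1) / (-Q) * (-Q) = P + 1 := div_mul_cancel₀ _ (by linarith)
        have hk0 : 0 ≤ (P + 1) / (-Q) := div_nonneg (by linarith) (by linarith)
        set k := (P + 1) / (-Q)
        nlinarith [mul_nonneg (mul_nonneg hk0 hk0) (by linarith : 0 ≤ -Q)]
      positivity
    · by_contra hneg
      push Not at hneg
      nlinarith [mul_pos h0 (sub_pos.mpr hneg)]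
  nlinarith [hfin]

/-- Inequality (4.2): if `Φ : 𝒜 → ℬ` is a unital positive linear map into a commutative
unital C*-algebra `ℬ`, then for self-adjoint `A, B ∈ 𝒜` the Schrödinger-type uncertainty
relation
`Var_Φ(A)·Var_Φ(B) ≥ |Re Cov_Φ(A,B)|² + (1/4)|Φ(AB − BA)|²`
holds, where `Cov_Φ(A,B) = Φ(AB) − Φ(A)Φ(B)`, `Var_Φ(A) = Cov_Φ(A,A)` and
`Re T = (T + T*)/2`. -/
theorem schrodinger_uncertainty_commutative_range
    {𝒜 ℬ : Type*} [CStarAlgebra 𝒜] [CommCStarAlgebra ℬ]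
    (Φ : 𝒜 →ₗ[ℂ] ℬ) (hunital : Φ 1 = 1)
    (hpos : ∀ a : 𝒜, IsPosElem a → IsPosElem (Φ a))
    (A B : 𝒜) (hA : star A = A) (hB : star B = B) :
    IsPosElem ((Φ (A * A) - Φ A * Φ A) * (Φ (B * B) - Φ B * Φ B) -
      (star ((1 / 2 : ℂ) • ((Φ (A * B) - Φ A * Φ B) + star (Φ (A * B) - Φ A * Φ B))) *
          ((1 / 2 : ℂ) • ((Φ (A * B) - Φ A * Φ B) + star (Φ (A * B) - Φ A * Φ B))) +
        (1 / 4 : ℂ) • (star (Φ (A * B - B * A)) * Φ (A * B - B * A)))) := by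
  apply isPosElem_of_characters
  intro χ
  have := state_schrodinger ((χ : ℬ →ₗ[ℂ] ℂ) ∘ₗ Φ) (by simp [hunital]) (by
    intro a
    obtain ⟨b, hb⟩ := hpos _ ⟨a, rfl⟩
    rw [LinearMap.comp_apply, hb]
    simpa [map_star] using complex_star_mul_self_nonneg (χ b)) A B hA hB
  simp only [LinearMap.comp_apply, LinearMap.coe_coe] at this
  simpa only [map_sub, map_add, map_mul, map_star, map_smul, smul_eq_mul] using this
end

section
/- Let ℳ and 𝒩 be von Neumann algebras and let Φ : ℳ → 𝒩 be a tracial positive (not necessarily linear) map with Φ(0) = 0 that admits a decomposition Φ = φ ∘ ψ, where ψ : ℳ → C(Ω) is a unital tracial positive linear map (Ω a compact Hausdorff space) and φ : C(Ω) → 𝒩 is a unital tracial m-positive map with m ≥ 4. Let ϱ ∈ ℳ be a positive element (a density operator), and let f and g be nonnegative continuous real-valued functions of same monotonicity defined on an interval containing the spectrum of ϱ. Then for all self-adjoint A, B ∈ ℳ the matrix [[I_{ϱ,Φ}^{f,g}(A), ⋆], [⋆, I_{ϱ,Φ}^{f,g}(B)]] is positive in M₂(𝒩), where I_{ϱ,Φ}^{f,g}(X)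 = Φ(f(ϱ)g(ϱ)X²) − Φ(f(ϱ)Xg(ϱ)X) and ⋆ = Φ((1/2)f(ϱ)g(ϱ)(AB + BA)) − Φ((1/2)(f(ϱ)Ag(ϱ)B + f(ϱ)Bg(ϱ)A)). -/
section SkewAux

open scoped ComplexOrder MatrixOrder unitInterval Matrix Topology

/-- A positive functional on a C*-algebra is continuous. -/
lemma skewAux_continuous {A : Type*} [CStarAlgebra A] (τ : A →ₗ[ℂ] ℂ)
    (hpos : ∀ x, 0 ≤ τ (star x * x)) : Continuous τ := by
  let _ : PartialOrder A := CStarAlgebra.spectralOrder A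
  have : StarOrderedRing A := CStarAlgebra.spectralOrderedRing A
  let p : A →ₚ[ℂ] ℂ := PositiveLinearMap.mk₀ τ (fun x hx => by
    obtain ⟨y, rfl⟩ := CStarAlgebra.nonneg_iff_eq_star_mul_self.mp hx
    exact hpos y)
  exact (map_continuous p : Continuous p)

lemma skewAux_nonneg {A : Type*} [CStarAlgebra A] (τ : A →ₗ[ℂ] ℂ)
    (hpos : ∀ x, 0 ≤ τ (star x * x)) (htr : ∀ x y, τ (x * y) = τ (y * x))
    (a b X : A) (hX : star X = X) :
    0 ≤ τ (star a * a * X * (star b * b * X)) := by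
  have h := hpos (b * X * star a)
  have e : τ (star a * a * X * (star b * b * X)) = τ (star (b * X * star a) * (b * X * star a)) := by
    rw [show star a * a * X * (star b * b * X) = star a * (a * X * (star b * b * X)) by
      simp only [mul_assoc], htr]
    simp only [star_mul, star_star, hX, mul_assoc]
  rwa [e]

lemma skewAux_theta_nonneg {A : Type*} [CStarAlgebra A] (θ : C(I, ℝ) →⋆ₐ[ℝ] A)
    (F : C(I, ℝ)) (hF : ∀ x, 0 ≤ F x) : ∃ a, θ F = star a * a := by
  refine ⟨θ ⟨fun x => Real.sqrt (F x), by fun_prop⟩, ?_⟩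
  rw [← map_star, ← map_mul]
  congr 1
  ext x
  simp [Real.mul_self_sqrt (hF x)]

lemma skewAux_core {A : Type*} [CStarAlgebra A] (τ : A →ₗ[ℂ] ℂ)
    (hpos : ∀ x, 0 ≤ τ (star x * x)) (htr : ∀ x y, τ (x * y) = τ (y * x))
    (θ : C(I, ℝ) →⋆ₐ[ℝ] A) (hθ : Continuous θ) (F G : C(I, ℝ))
    (hmono : ∀ x y, 0 ≤ (F x - F y) * (G x - G y))
    (X : A) (hX : star X = X) :
    0 ≤ τ (θ F * θ G * (X * X)) - τ (θ F * X * (θ G * X)) := by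
  have hτ := skewAux_continuous τ hpos
  have hF := (hθ.tendsto _).comp (bernsteinApproximation_uniform F)
  have hG := (hθ.tendsto _).comp (bernsteinApproximation_uniform G)
  have hFG := (hθ.tendsto _).comp (bernsteinApproximation_uniform (F * G))
  rw [← map_mul]
  have hlim := ((hτ.tendsto _).comp (hFG.mul_const (X * X))).sub
    ((hτ.tendsto _).comp ((hF.mul_const X).mul (hG.mul_const X)))
  refine ge_of_tendsto' hlim (fun n => ?_)
  simp only [Function.comp_apply]
  let b : Fin (n + 1) → A := fun k => θ (bernstein n k)
  have happ : ∀ E : C(I, ℝ), θ (bernsteinApproximation n E) =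
      ∑ k : Fin (n + 1), ((E (bernstein.z k) : ℝ) : ℂ) • b k := by
    intro E
    have : bernsteinApproximation n E =
        ∑ k : Fin (n + 1), (E (bernstein.z k)) • (bernstein n k) := by
      ext x
      simp [bernsteinApproximation.apply, ContinuousMap.sum_apply, mul_comm]
    rw [this, map_sum]
    refine Finset.sum_congr rfl (fun k _ => ?_)
    rw [map_smul, Complex.coe_smul]
  have hone : ∑ k, b k = 1 := by
    rw [← map_sum, ← map_one θ]
    congr 1
    ext x
    simpa [ContinuousMap.sum_apply] using bernstein.probability n x
  let w : Fin (n + 1) → Fin (n + 1) → ℂ := fun i j => τ (b i * X * (b j * X))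
  have hw0 : ∀ i j, 0 ≤ w i j := by
    intro i j
    obtain ⟨p, hp⟩ := skewAux_theta_nonneg θ (bernstein n i) (fun x => bernstein_nonneg)
    obtain ⟨q, hq⟩ := skewAux_theta_nonneg θ (bernstein n j) (fun x => bernstein_nonneg)
    simp only [w, b, hp, hq]
    exact skewAux_nonneg τ hpos htr p q X hX
  have hws : ∀ i j, w i j = w j i := by
    intro i j
    simp only [w]
    rw [htr]
  have h1 : ∀ i, τ (b i * (X * X)) = ∑ j, w i j := by
    intro i
    simp only [w]
    rw [← map_sum, ← Finset.mul_sum, ← Finset.sum_mul, hone]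
    simp [mul_assoc]
  set fz : Fin (n + 1) → ℂ := fun k => ((F (bernstein.z k) : ℝ) : ℂ) with hfz
  set gz : Fin (n + 1) → ℂ := fun k => ((G (bernstein.z k) : ℝ) : ℂ) with hgz
  have e1 : τ (θ (bernsteinApproximation n (F * G)) * (X * X)) =
      ∑ i, ∑ j, fz i * gz i * w i j := by
    rw [happ, Finset.sum_mul, map_sum]
    refine Finset.sum_congr rfl (fun i _ => ?_)
    rw [smul_mul_assoc, map_smul, h1, smul_eq_mul, Finset.mul_sum]
    simp [fz, gz]
  have e2 : τ (θ (bernsteinApproximation n F) * X * (θ (bernsteinApproximation n G) * X)) =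
      ∑ i, ∑ j, fz i * gz j * w i j := by
    rw [happ, happ]
    simp only [Finset.sum_mul, Finset.mul_sum, map_sum, smul_mul_assoc, mul_smul_comm, map_smul,
      smul_eq_mul]
    rw [Finset.sum_comm]
    refine Finset.sum_congr rfl (fun i _ => Finset.sum_congr rfl (fun j _ => ?_))
    simp only [fz, gz, w]
    ring
  have e3 : (∑ i, ∑ j, fz i * gz i * w i j) - ∑ i, ∑ j, fz i * gz j * w i j
      = (1 / 2 : ℂ) * ∑ i, ∑ j, (fz i - fz j) * (gz i - gz j) * w i j := by
    have s1 : ∑ i, ∑ j, fz j * gz j * w i j = ∑ i, ∑ j, fz i * gz i * w i j := by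
      rw [Finset.sum_comm]
      exact Finset.sum_congr rfl (fun i _ => Finset.sum_congr rfl (fun j _ => by rw [hws j i]))
    have s2 : ∑ i, ∑ j, fz j * gz i * w i j = ∑ i, ∑ j, fz i * gz j * w i j := by
      rw [Finset.sum_comm]
      exact Finset.sum_congr rfl (fun i _ => Finset.sum_congr rfl (fun j _ => by rw [hws j i]))
    have s3 : ∑ i, ∑ j, (fz i - fz j) * (gz i - gz j) * w i j =
        (∑ i, ∑ j, fz i * gz i * w i j) - (∑ i, ∑ j, fz i * gz j * w i j)
        - (∑ i, ∑ j, fz j * gz i * w i j) + ∑ i, ∑ j, fz j * gz j * w i j := by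
      simp only [← Finset.sum_sub_distrib, ← Finset.sum_add_distrib]
      exact Finset.sum_congr rfl (fun i _ => Finset.sum_congr rfl (fun j _ => by ring))
    rw [s3, s1, s2]
    ring
  rw [e1, e2, e3]
  refine mul_nonneg (by simp) (Finset.sum_nonneg fun i _ => Finset.sum_nonneg fun j _ =>
    mul_nonneg ?_ (hw0 i j))
  have := hmono (bernstein.z i) (bernstein.z j)
  simp only [fz, gz]
  exact_mod_cast this

/-- The main trace inequality. -/
lemma skewAux_main {A : Type*} [CStarAlgebra A] (τ : A →ₗ[ℂ] ℂ)
    (hpos : ∀ x, 0 ≤ τ (star x * x)) (htr : ∀ x y, τ (x * y) = τ (y * x))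
    (r : A) (hr : IsSelfAdjoint r)
    (s : Set ℝ) (hs : s.OrdConnected) (hspec : spectrum ℝ r ⊆ s)
    (f g : ℝ → ℝ) (hfc : ContinuousOn f s) (hgc : ContinuousOn g s)
    (hf0 : ∀ x ∈ s, 0 ≤ f x) (hg0 : ∀ x ∈ s, 0 ≤ g x)
    (hmono : ∀ x ∈ s, ∀ y ∈ s, 0 ≤ (f x - f y) * (g x - g y))
    (X : A) (hX : star X = X) :
    0 ≤ τ (cfc f r * X * (cfc g r * X)) ∧
    0 ≤ τ (cfc f r * cfc g r * (X * X)) - τ (cfc f r * X * (cfc g r * X)) := by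
  rcases subsingleton_or_nontrivial A with hA | hA
  · have : ∀ x : A, τ x = 0 := fun x => by rw [Subsingleton.elim x 0, map_zero]
    simp [this]
  have hne : (spectrum ℝ r).Nonempty := ContinuousFunctionalCalculus.spectrum_nonempty r hr
  have hcpt : IsCompact (spectrum ℝ r) := spectrum.isCompact r
  obtain ⟨a, ha, hamin⟩ := hcpt.exists_isLeast hne
  obtain ⟨b, hb, hbmax⟩ := hcpt.exists_isGreatest hne
  have hab : a ≤ b := hamin hb
  have hIcc : Set.Icc a b ⊆ s := hs.out (hspec ha) (hspec hb)
  -- the path from the unit interval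
  let γ : I → ℝ := fun t => min b (a + t * (b - a + 1))
  have hγ : ∀ t, γ t ∈ s := fun t => hIcc ⟨le_min hab (by
    have : 0 ≤ (t : ℝ) * (b - a + 1) := mul_nonneg t.2.1 (by linarith)
    linarith), min_le_left _ _⟩
  have hγc : Continuous γ := by fun_prop
  let F : C(I, ℝ) := ⟨fun t => f (γ t), hfc.comp_continuous hγc hγ⟩
  let G : C(I, ℝ) := ⟨fun t => g (γ t), hgc.comp_continuous hγc hγ⟩
  let δ : C(spectrum ℝ r, I) := ⟨fun x => ⟨(x - a) / (b - a + 1), by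
      have h1 := hamin x.2
      have h2 := hbmax x.2
      constructor
      · exact div_nonneg (by linarith) (by linarith)
      · rw [div_le_one (by linarith)]; linarith⟩, by fun_prop⟩
  have hγδ : ∀ x, γ (δ x) = x := by
    intro x
    have h2 := hbmax x.2
    have h3 : b - a + 1 ≠ 0 := by linarith
    simp only [γ, δ, ContinuousMap.coe_mk]
    rw [div_mul_cancel₀ _ h3]
    simp [h2]
  let θ : C(I, ℝ) →⋆ₐ[ℝ] A := (cfcHom hr).comp (ContinuousMap.compStarAlgHom' ℝ ℝ δ)
  have hθ : Continuous θ := (cfcHom_continuous hr).comp (ContinuousMap.continuous_precomp δ)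
  have hF : θ F = cfc f r := by
    rw [cfc_apply f r hr (hfc.mono hspec)]
    simp only [θ, StarAlgHom.comp_apply]
    congr 1
    ext x
    simp [F, hγδ]
  have hG : θ G = cfc g r := by
    rw [cfc_apply g r hr (hgc.mono hspec)]
    simp only [θ, StarAlgHom.comp_apply]
    congr 1
    ext x
    simp [G, hγδ]
  rw [← hF, ← hG]
  constructor
  · obtain ⟨p, hp⟩ := skewAux_theta_nonneg θ F (fun t => hf0 _ (hγ t))
    obtain ⟨q, hq⟩ := skewAux_theta_nonneg θ G (fun t => hg0 _ (hγ t))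
    rw [hp, hq]
    exact skewAux_nonneg τ hpos htr p q X hX
  · exact skewAux_core τ hpos htr θ hθ F G (fun t u => hmono _ (hγ t) _ (hγ u)) X hX

lemma skewAux_psd2 (a b d : ℂ)
    (h : ∀ x y : ℝ, 0 ≤ (x : ℂ) ^ 2 * a + 2 * x * y * b + (y : ℂ) ^ 2 * d) :
    (!![a, b; b, d] : Matrix (Fin 2) (Fin 2) ℂ).PosSemidef := by
  have ha : 0 ≤ a := by simpa using h 1 0
  have hd : 0 ≤ d := by simpa using h 0 1
  have hab := h 1 1
  have ha' := Complex.nonneg_iff.mp ha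
  have hd' := Complex.nonneg_iff.mp hd
  have hb' := Complex.nonneg_iff.mp hab
  have hbim : b.im = 0 := by
    have := hb'.2
    simp at this
    linarith [ha'.2, hd'.2]
  obtain ⟨a, rfl⟩ : ∃ r : ℝ, a = r := ⟨a.re, by apply Complex.ext <;> simp [← ha'.2]⟩
  obtain ⟨b, rfl⟩ : ∃ r : ℝ, b = r := ⟨b.re, by apply Complex.ext <;> simp [hbim]⟩
  obtain ⟨d, rfl⟩ : ∃ r : ℝ, d = r := ⟨d.re, by apply Complex.ext <;> simp [← hd'.2]⟩
  have h' : ∀ x y : ℝ, 0 ≤ x ^ 2 * a + 2 * x * y * b + y ^ 2 * d := fun x y => by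
    exact_mod_cast h x y
  refine Matrix.PosSemidef.of_dotProduct_mulVec_nonneg ?_ ?_
  · ext i j
    fin_cases i <;> fin_cases j <;> simp
  · intro v
    rw [Complex.nonneg_iff]
    have h1 := h' (v 0).re (v 1).re
    have h2 := h' (v 0).im (v 1).im
    constructor
    · simp [Matrix.mulVec, dotProduct, Fin.sum_univ_two]
      nlinarith
    · simp [Matrix.mulVec, dotProduct, Fin.sum_univ_two]
      ring

lemma skewAux_psd4 (P Q : Matrix (Fin 2) (Fin 2) ℂ) (hQ : Q.PosSemidef)
    (hPQ : (P - Q).PosSemidef) : (Matrix.fromBlocks P Q Q Q).PosSemidef := by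
  have h1 := hQ.submatrix (Sum.elim id id : Fin 2 ⊕ Fin 2 → Fin 2)
  have h2 := hPQ.conjTranspose_mul_mul_same (Matrix.fromCols (1 : Matrix (Fin 2) (Fin 2) ℂ) (0 : Matrix (Fin 2) (Fin 2) ℂ))
  convert h1.add h2 using 1
  ext i j
  rcases i with i | i <;> rcases j with j | j <;>
    simp [Matrix.conjTranspose_fromCols_eq_fromRows_conjTranspose, Matrix.fromRows_mul]

lemma skewAux_sqrt {A : Type*} [CStarAlgebra A] {Ω : Type*} [TopologicalSpace Ω] (k : Ω → A)
    (hkc : Continuous k) (hk : ∀ ω, ∃ b, k ω = star b * b) :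
    ∃ t : Ω → A, Continuous t ∧ ∀ ω, k ω = star (t ω) * t ω := by
  let _ : PartialOrder A := CStarAlgebra.spectralOrder A
  have : StarOrderedRing A := CStarAlgebra.spectralOrderedRing A
  have hk0 : ∀ ω, 0 ≤ k ω := fun ω => CStarAlgebra.nonneg_iff_eq_star_mul_self.mpr (hk ω)
  refine ⟨fun ω => CFC.sqrt (k ω), CFC.continuousOn_sqrt.comp_continuous hkc hk0, fun ω => ?_⟩
  rw [(CFC.sqrt_nonneg (k ω)).isSelfAdjoint.star_eq, CFC.sqrt_mul_sqrt_self _ (hk0 ω)]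

lemma skewAux_sum {A : Type*} [CStarAlgebra A] {m : Type*} [Fintype m] (E : m → A) :
    ∃ S, ∑ k, star (E k) * E k = star S * S := by
  let _ : PartialOrder A := CStarAlgebra.spectralOrder A
  have : StarOrderedRing A := CStarAlgebra.spectralOrderedRing A
  exact CStarAlgebra.nonneg_iff_eq_star_mul_self.mp
    (Finset.sum_nonneg fun k _ => star_mul_self_nonneg _)

/-- A pointwise positive semidefinite matrix of continuous functions is positive. -/
lemma skewAux_pointwise {Ω : Type*} [TopologicalSpace Ω] {n : Type*} [Fintype n] [DecidableEq n]
    (K : Matrix n n C(Ω, ℂ)) (hK : ∀ ω, (K.map (fun F => F ω)).PosSemidef) : IsPosElem K := by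
  let k : Ω → CStarMatrix n n ℂ := fun ω => CStarMatrix.ofMatrix (K.map (fun F => F ω))
  have hk0 : ∀ ω, ∃ b, k ω = star b * b := by
    intro ω
    obtain ⟨B, hB⟩ := CStarAlgebra.nonneg_iff_eq_star_mul_self.mp
      (Matrix.nonneg_iff_posSemidef.mpr (hK ω))
    exact ⟨CStarMatrix.ofMatrix B, hB⟩
  have hkc : Continuous k := by
    refine continuous_pi fun i => continuous_pi fun j => ?_
    exact (K i j).continuous
  obtain ⟨t, htc, ht⟩ := skewAux_sqrt k hkc hk0
  have hsij : ∀ i j, Continuous (fun ω => (t ω) i j) := fun i j => by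
    exact (continuous_apply j).comp ((continuous_apply i).comp htc)
  refine ⟨Matrix.of fun i j => ⟨_, hsij i j⟩, ?_⟩
  ext i j ω
  have h2 : k ω i j = (star (t ω) * t ω) i j := congrFun (congrFun (ht ω) i) j
  have h3 : k ω i j = ∑ l, star (t ω l i) * t ω l j := h2
  simp only [Matrix.mul_apply, Matrix.star_apply, ContinuousMap.sum_apply]
  exact h3

lemma skewAux_final {N : Type*} [CStarAlgebra N] {m : Type*} [Fintype m]
    (D : m → Fin 2 → N) (T : Matrix (Fin 2) (Fin 2) N)
    (hT : ∀ i j, T i j = ∑ k, star (D k i) * D k j) : IsPosElem T := by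
  let _ : PartialOrder N := CStarAlgebra.spectralOrder N
  have : StarOrderedRing N := CStarAlgebra.spectralOrderedRing N
  let E : m → CStarMatrix (Fin 2) (Fin 2) N := fun k => CStarMatrix.ofMatrix
    (Matrix.of fun l j => if l = 0 then D k j else 0)
  have hE : CStarMatrix.ofMatrix T = ∑ k, star (E k) * E k := by
    ext i j
    have : (∑ k, star (E k) * E k) i j = ∑ k, (star (E k) * E k) i j :=
      Matrix.sum_apply i j _ _
    rw [this]
    refine (hT i j).trans (Finset.sum_congr rfl fun k _ => ?_)
    simp [CStarMatrix.mul_apply, CStarMatrix.star_apply, E]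
  obtain ⟨S, hS⟩ := skewAux_sum E
  exact ⟨S, hE.trans hS⟩

/-- Monotonicity of the induced map, via `4`-positivity. -/
lemma skewAux_four {N : Type*} [CStarAlgebra N] {Ω : Type*} [TopologicalSpace Ω]
    (φ : C(Ω, ℂ) → N) (m : ℕ) (hm : 4 ≤ m) (hφm : IsNPosMap m φ)
    (P Q : Matrix (Fin 2) (Fin 2) C(Ω, ℂ))
    (hQ : ∀ ω, (Q.map (fun F => F ω)).PosSemidef)
    (hPQ : ∀ ω, (P.map (fun F => F ω) - Q.map (fun F => F ω)).PosSemidef) :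
    IsPosElem (Matrix.of fun i j => φ (P i j) - φ (Q i j)) := by
  obtain ⟨c⟩ : Nonempty (Fin 2 ⊕ Fin 2 ↪ Fin m) :=
    Function.Embedding.nonempty_of_card_le (by simpa using hm)
  let r := Function.invFun c
  have hrc : ∀ i, r (c i) = i := Function.leftInverse_invFun c.injective
  let L := Matrix.fromBlocks P Q Q Q
  have hK : IsPosElem (L.submatrix r r) := by
    refine skewAux_pointwise _ fun ω => ?_
    have := (skewAux_psd4 _ _ (hQ ω) (hPQ ω)).submatrix r
    rwa [← Matrix.fromBlocks_map] at this
  obtain ⟨b, hb⟩ := hφm _ hK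
  have hb' : ∀ i j, φ (L i j) = ∑ k, star (b k (c i)) * b k (c j) := by
    intro i j
    have := congrFun (congrFun hb (c i)) (c j)
    simpa [Matrix.mul_apply, Matrix.star_apply, hrc] using this
  refine skewAux_final (fun k i => b k (c (Sum.inl i)) - b k (c (Sum.inr i))) _ fun i j => ?_
  have h1 := hb' (Sum.inl i) (Sum.inl j)
  have h2 := hb' (Sum.inl i) (Sum.inr j)
  have h3 := hb' (Sum.inr i) (Sum.inl j)
  have h4 := hb' (Sum.inr i) (Sum.inr j)
  simp only [L, Matrix.fromBlocks_apply₁₁, Matrix.fromBlocks_apply₁₂, Matrix.fromBlocks_apply₂₁,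
    Matrix.fromBlocks_apply₂₂] at h1 h2 h3 h4
  simp only [star_sub, sub_mul, mul_sub, Finset.sum_sub_distrib, ← h1, ← h2, ← h3, ← h4,
    Matrix.of_apply]
  abel

lemma skewAux_closed {H : Type*} [NormedAddCommGroup H] [InnerProductSpace ℂ H] [CompleteSpace H]
    (M : VonNeumannAlgebra H) : IsClosed (M.toStarSubalgebra : Set (H →L[ℂ] H)) := by
  rw [VonNeumannAlgebra.coe_toStarSubalgebra, ← M.centralizer_centralizer]
  exact Set.isClosed_centralizer _

lemma skewAux_spectrum {A : Type*} [CStarAlgebra A] (S : StarSubalgebra ℂ A)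
    (hS : IsClosed (S : Set A)) (a : S) : spectrum ℝ a ⊆ spectrum ℝ (a : A) := by
  intro r hr h
  apply hr
  have : ((algebraMap ℝ S r - a : S) : A) = algebraMap ℝ A r - a := rfl
  have h' : IsUnit (algebraMap ℝ A r - (a : A)) := h
  rw [← this] at h'
  exact (StarSubalgebra.coe_isUnit S).mp h'

lemma skewAux_cfc {A : Type*} [CStarAlgebra A] (S : StarSubalgebra ℂ A)
    [hS : IsClosed (S : Set A)] (a : S) (ha : IsSelfAdjoint a) (f : ℝ → ℝ)
    (hf : ContinuousOn f (spectrum ℝ (a : A))) (b : S) (hb : (b : A) = cfc f (a : A)) :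
    b = cfc f a := by
  apply Subtype.ext
  rw [hb]
  have := StarAlgHomClass.map_cfc S.subtype f a (hf.mono (skewAux_spectrum S hS a))
    continuous_subtype_val ha (ha.map S.subtype)
  exact this.symm

end SkewAux

/-- Theorem 4.4: let `Φ : ℳ → 𝒩` be a tracial positive map between von Neumann algebras
with `Φ(0) = 0` admitting a decomposition `Φ = φ ∘ ψ` with `ψ : ℳ → C(Ω)` a unital tracial
positive linear map and `φ : C(Ω) → 𝒩` a unital tracial `m`-positive map, `m ≥ 4`.
If `ϱ` is a density operator and `f, g` are nonnegative continuous real-valued functions of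
the same monotonicity on an interval containing the spectrum of `ϱ`, then the generalized
skew-information matrix `[[I_{ϱ,Φ}^{f,g}(A), ⋆], [⋆, I_{ϱ,Φ}^{f,g}(B)]]` is positive,
where `I_{ϱ,Φ}^{f,g}(X) = Φ(f(ϱ)g(ϱ)X²) − Φ(f(ϱ)Xg(ϱ)X)` and
`⋆ = Φ((1/2)f(ϱ)g(ϱ)(AB+BA)) − Φ((1/2)(f(ϱ)Ag(ϱ)B + f(ϱ)Bg(ϱ)A))`. -/
theorem skew_information_matrix_positive
    {H₁ H₂ : Type*}
    [NormedAddCommGroup H₁] [InnerProductSpace ℂ H₁] [CompleteSpace H₁]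
    [NormedAddCommGroup H₂] [InnerProductSpace ℂ H₂] [CompleteSpace H₂]
    (M : VonNeumannAlgebra H₁) (N : VonNeumannAlgebra H₂)
    (Φ : ↥M.toStarSubalgebra → ↥N.toStarSubalgebra)
    (hΦtr : ∀ X Y : ↥M.toStarSubalgebra, Φ (X * Y) = Φ (Y * X))
    (hΦpos : ∀ X : ↥M.toStarSubalgebra, IsPosElem X → IsPosElem (Φ X))
    (hΦ0 : Φ 0 = 0)
    {Ω : Type*} [TopologicalSpace Ω] [CompactSpace Ω] [T2Space Ω]
    (ψ : ↥M.toStarSubalgebra →ₗ[ℂ] C(Ω, ℂ)) (hψ1 : ψ 1 = 1)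
    (hψtr : ∀ X Y : ↥M.toStarSubalgebra, ψ (X * Y) = ψ (Y * X))
    (hψpos : ∀ X : ↥M.toStarSubalgebra, IsPosElem X → IsPosElem (ψ X))
    (φ : C(Ω, ℂ) → ↥N.toStarSubalgebra) (hφ1 : φ 1 = 1)
    (hφtr : ∀ F G : C(Ω, ℂ), φ (F * G) = φ (G * F))
    (m : ℕ) (hm : 4 ≤ m) (hφm : IsNPosMap m φ)
    (hdec : ∀ X : ↥M.toStarSubalgebra, Φ X = φ (ψ X))
    (ϱ : ↥M.toStarSubalgebra) (hϱ : IsPosElem ϱ)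
    (s : Set ℝ) (hs : s.OrdConnected) (hspec : spectrum ℝ ((ϱ : H₁ →L[ℂ] H₁)) ⊆ s)
    (f g : ℝ → ℝ) (hfc : ContinuousOn f s) (hgc : ContinuousOn g s)
    (hf0 : ∀ x ∈ s, 0 ≤ f x) (hg0 : ∀ x ∈ s, 0 ≤ g x)
    (hmono : ∀ x ∈ s, ∀ y ∈ s, 0 ≤ (f x - f y) * (g x - g y))
    (fϱ gϱ : ↥M.toStarSubalgebra)
    (hf : (fϱ : H₁ →L[ℂ] H₁) = cfc f (ϱ : H₁ →L[ℂ] H₁))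
    (hg : (gϱ : H₁ →L[ℂ] H₁) = cfc g (ϱ : H₁ →L[ℂ] H₁))
    (A B : ↥M.toStarSubalgebra) (hA : star A = A) (hB : star B = B) :
    IsPosElem
      !![Φ (fϱ * gϱ * (A * A)) - Φ (fϱ * A * (gϱ * A)),
         Φ ((1 / 2 : ℂ) • (fϱ * gϱ * (A * B + B * A))) -
           Φ ((1 / 2 : ℂ) • (fϱ * A * (gϱ * B) + fϱ * B * (gϱ * A)));
         Φ ((1 / 2 : ℂ) • (fϱ * gϱ * (A * B + B * A))) -
           Φ ((1 / 2 : ℂ) • (fϱ * A * (gϱ * B) + fϱ * B * (gϱ * A))),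
         Φ (fϱ * gϱ * (B * B)) - Φ (fϱ * B * (gϱ * B))] := by
  have hM : IsClosed (M.toStarSubalgebra : Set (H₁ →L[ℂ] H₁)) := skewAux_closed M
  have hN : IsClosed (N.toStarSubalgebra : Set (H₂ →L[ℂ] H₂)) := skewAux_closed N
  have hsa : IsSelfAdjoint ϱ := by
    obtain ⟨b, rfl⟩ := hϱ
    exact IsSelfAdjoint.star_mul_self b
  have hf' := skewAux_cfc M.toStarSubalgebra ϱ hsa f (hfc.mono hspec) fϱ hf
  have hg' := skewAux_cfc M.toStarSubalgebra ϱ hsa g (hgc.mono hspec) gϱ hg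
  have hspec' := (skewAux_spectrum M.toStarSubalgebra hM ϱ).trans hspec
  let P : Matrix (Fin 2) (Fin 2) C(Ω, ℂ) :=
    !![ψ (fϱ * gϱ * (A * A)), ψ ((1 / 2 : ℂ) • (fϱ * gϱ * (A * B + B * A)));
       ψ ((1 / 2 : ℂ) • (fϱ * gϱ * (A * B + B * A))), ψ (fϱ * gϱ * (B * B))]
  let Q : Matrix (Fin 2) (Fin 2) C(Ω, ℂ) :=
    !![ψ (fϱ * A * (gϱ * A)), ψ ((1 / 2 : ℂ) • (fϱ * A * (gϱ * B) + fϱ * B * (gϱ * A)));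
       ψ ((1 / 2 : ℂ) • (fϱ * A * (gϱ * B) + fϱ * B * (gϱ * A))), ψ (fϱ * B * (gϱ * B))]
  let τ : Ω → (↥M.toStarSubalgebra →ₗ[ℂ] ℂ) := fun ω =>
    { toFun := fun X => ψ X ω
      map_add' := fun X Y => by simp
      map_smul' := fun c X => by simp }
  have hτψ : ∀ ω X, ψ X ω = τ ω X := fun _ _ => rfl
  open scoped ComplexOrder in
  have key : ∀ ω (x y : ℝ),
      0 ≤ τ ω (fϱ * ((x : ℂ) • A + (y : ℂ) • B) * (gϱ * ((x : ℂ) • A + (y : ℂ) • B))) ∧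
      0 ≤ τ ω (fϱ * gϱ * (((x : ℂ) • A + (y : ℂ) • B) * ((x : ℂ) • A + (y : ℂ) • B))) -
        τ ω (fϱ * ((x : ℂ) • A + (y : ℂ) • B) * (gϱ * ((x : ℂ) • A + (y : ℂ) • B))) := by
    intro ω x y
    rw [hf', hg']
    refine skewAux_main (τ ω) (fun X => ?_) (fun X Y => ?_) ϱ hsa s hs hspec' f g hfc hgc
      hf0 hg0 hmono _ ?_
    · obtain ⟨b, hb⟩ := hψpos (star X * X) ⟨X, rfl⟩
      rw [← hτψ, hb]
      exact star_mul_self_nonneg (b ω)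
    · rw [← hτψ, ← hτψ, hψtr]
    · simp [star_add, star_smul, hA, hB]
  have hfin := skewAux_four φ m hm hφm P Q (fun ω => ?_) (fun ω => ?_)
  · convert hfin using 1
    ext i j
    fin_cases i <;> fin_cases j <;> simp [P, Q, hdec]
  · have : Q.map (fun F => F ω) = !![τ ω (fϱ * A * (gϱ * A)),
        τ ω ((1 / 2 : ℂ) • (fϱ * A * (gϱ * B) + fϱ * B * (gϱ * A)));
        τ ω ((1 / 2 : ℂ) • (fϱ * A * (gϱ * B) + fϱ * B * (gϱ * A))),
        τ ω (fϱ * B * (gϱ * B))] := by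
      ext i j
      fin_cases i <;> fin_cases j <;> rfl
    rw [this]
    refine skewAux_psd2 _ _ _ fun x y => ?_
    convert (key ω x y).1 using 1
    simp only [mul_add, add_mul, smul_mul_assoc, mul_smul_comm, map_add, map_smul, smul_eq_mul]
    ring
  · have : P.map (fun F => F ω) - Q.map (fun F => F ω) =
        !![τ ω (fϱ * gϱ * (A * A)) - τ ω (fϱ * A * (gϱ * A)),
        τ ω ((1 / 2 : ℂ) • (fϱ * gϱ * (A * B + B * A))) -
          τ ω ((1 / 2 : ℂ) • (fϱ * A * (gϱ * B) + fϱ * B * (gϱ * A)));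
        τ ω ((1 / 2 : ℂ) • (fϱ * gϱ * (A * B + B * A))) -
          τ ω ((1 / 2 : ℂ) • (fϱ * A * (gϱ * B) + fϱ * B * (gϱ * A))),
        τ ω (fϱ * gϱ * (B * B)) - τ ω (fϱ * B * (gϱ * B))] := by
      ext i j
      fin_cases i <;> fin_cases j <;> rfl
    rw [this]
    refine skewAux_psd2 _ _ _ fun x y => ?_
    convert (key ω x y).2 using 1
    simp only [mul_add, add_mul, smul_mul_assoc, mul_smul_comm, map_add, map_smul, smul_eq_mul]
    ring
end

section
/- Let Φ : 𝒜₁ ⊕ ⋯ ⊕ 𝒜_k → ℬ be a unital positive (not necessarily linear or multilinear) map between unital C*-algebras with Φ(𝟎) = 0. If Φ is (2k+1)-positive, then for all 𝐀 = (A₁, …, A_k) and 𝐁 = (B₁, …, B_k) in ⊕ᵢ₌₁ᵏ𝒜ᵢ the partial variance-covariance matrix [[ᵖVar_Φ(𝐀), ᵖCov_Φ(𝐀,𝐁)], [ᵖCov_Φ(𝐁,𝐀), ᵖVar_Φ(𝐁)]] is positive in M_{2k}(ℬ). -/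
/-- The partial covariance matrix `ᵖCov_Φ(𝐀,𝐁) ∈ M_k(ℬ)` of `𝐀, 𝐁 ∈ ⊕ᵢ𝒜ᵢ` with respect
to a unital map `Φ : ⊕ᵢ𝒜ᵢ → ℬ`; its `(i,j)` entry is
`Φ(𝐄ᵢ(Aᵢ*)·𝐄ⱼ(Bⱼ)) − Φ(𝐄ᵢ(Aᵢ*))·Φ(𝐄ⱼ(Bⱼ))`, where `𝐄ᵢ(A)` denotes the `k`-tuple with
`A` in slot `i` and units elsewhere. -/
def pCov {k : ℕ} {A : Fin k → Type*} [∀ i, Ring (A i)] [∀ i, StarRing (A i)]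
    {B : Type*} [Ring B] (Φ : (∀ i, A i) → B) (X Y : ∀ i, A i) :
    Matrix (Fin k) (Fin k) B :=
  Matrix.of fun i j =>
    Φ (Function.update (1 : ∀ i, A i) i (star (X i)) * Function.update (1 : ∀ i, A i) j (Y j)) -
      Φ (Function.update (1 : ∀ i, A i) i (star (X i))) * Φ (Function.update (1 : ∀ i, A i) j (Y j))

theorem exists_star_mul_self_sum {m E : Type*} [Fintype m] [CStarAlgebra E] (R : m → E) :
    ∃ b : E, ∑ r, star (R r) * R r = star b * b := by
  let _ : PartialOrder E := CStarAlgebra.spectralOrder E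
  have _ : StarOrderedRing E := CStarAlgebra.spectralOrderedRing E
  exact CStarAlgebra.nonneg_iff_eq_star_mul_self.mp
    (Finset.sum_nonneg fun r _ => star_mul_self_nonneg _)

open scoped Matrix in
theorem isPosElem_conjTranspose_mul_rect {m n B : Type*} [Fintype m] [Fintype n]
    [CStarAlgebra B] (D : Matrix m n B) :
    IsPosElem (Dᴴ * D) := by
  classical
  let : PartialOrder B := CStarAlgebra.spectralOrder B
  have : StarOrderedRing B := CStarAlgebra.spectralOrderedRing B
  rcases isEmpty_or_nonempty n with hn | ⟨⟨n0⟩⟩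
  · exact ⟨0, Subsingleton.elim _ _⟩
  let R : m → CStarMatrix n n B := fun r => CStarMatrix.ofMatrix
    (Matrix.of fun i j => if i = n0 then D r j else 0)
  obtain ⟨b, hb⟩ := exists_star_mul_self_sum R
  refine ⟨CStarMatrix.ofMatrix.symm b, ?_⟩
  ext i j
  have h2 := congrFun (congrFun hb i) j
  have h3 : (∑ r, star (R r) * R r) i j = ∑ r, (star (R r) * R r) i j := by
    have : ∀ s : Finset m, (∑ r ∈ s, star (R r) * R r) i j
        = ∑ r ∈ s, (star (R r) * R r) i j := by
      intro s
      induction s using Finset.induction_on with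
      | empty => simp
      | insert a s ha ih => rw [Finset.sum_insert ha, Finset.sum_insert ha, ← ih]; rfl
    exact this _
  rw [h3] at h2
  have h4 : (star b * b) i j
      = (star (CStarMatrix.ofMatrix.symm b) * CStarMatrix.ofMatrix.symm b) i j := rfl
  rw [← h4, ← h2, Matrix.mul_apply]
  refine Finset.sum_congr rfl fun r _ => ?_
  rw [CStarMatrix.mul_apply, Finset.sum_eq_single n0]
  · simp [R, CStarMatrix.star_apply]
  · intro l _ hl
    simp [R, hl]
  · simp

open scoped Matrix in
theorem isPosElem_schur {m n B : Type*} [Fintype m] [Fintype n]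
    [CStarAlgebra B] (C : Matrix m m B) (p : m) (σ : n → m) (h : (Cᴴ * C) p p = 1) :
    IsPosElem (Matrix.of fun i j : n =>
      (Cᴴ * C) (σ i) (σ j) - (Cᴴ * C) (σ i) p * (Cᴴ * C) p (σ j)) := by
  let c : Matrix m Unit B := C.submatrix id (fun _ => p)
  let D : Matrix m n B := C.submatrix id σ
  have hc : cᴴ * c = 1 := by
    ext i j
    have : (cᴴ * c) i j = (Cᴴ * C) p p := rfl
    rw [this, h]; simp
  have key : (D - c * (cᴴ * D))ᴴ * (D - c * (cᴴ * D)) = Dᴴ * D - (Dᴴ * c) * (cᴴ * D) := by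
    have e : cᴴ * (D - c * (cᴴ * D)) = 0 := by
      rw [Matrix.mul_sub, ← Matrix.mul_assoc, hc, Matrix.one_mul, sub_self]
    rw [Matrix.conjTranspose_sub, Matrix.conjTranspose_mul c, Matrix.sub_mul,
      Matrix.mul_assoc (_ᴴ) cᴴ, e, Matrix.mul_zero, sub_zero, Matrix.mul_sub, Matrix.mul_assoc]
  have := isPosElem_conjTranspose_mul_rect (D - c * (cᴴ * D))
  rw [key] at this
  convert this using 1
  ext i j
  rw [Matrix.sub_apply, Matrix.mul_apply (M := Dᴴ * c)]
  simp only [Finset.univ_unique, Finset.sum_singleton]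
  rfl

/-- Theorem 4.6 (i): if `Φ : 𝒜₁ ⊕ ⋯ ⊕ 𝒜_k → ℬ` is a unital positive (not necessarily
linear) map with `Φ(𝟎) = 0` which is `(2k+1)`-positive, then the partial
variance-covariance matrix
`[[ᵖVar_Φ(𝐀), ᵖCov_Φ(𝐀,𝐁)], [ᵖCov_Φ(𝐁,𝐀), ᵖVar_Φ(𝐁)]]` is positive in `M_{2k}(ℬ)`. -/
theorem partial_variance_covariance_matrix_positive
    {k : ℕ} {A : Fin k → Type*} [∀ i, CStarAlgebra (A i)] {B : Type*} [CStarAlgebra B]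
    (Φ : (∀ i, A i) → B) (hunital : Φ 1 = 1)
    (hpos : ∀ x : ∀ i, A i, IsPosElem x → IsPosElem (Φ x)) (h0 : Φ 0 = 0)
    (h2k1 : IsNPosMap (2 * k + 1) Φ) (X Y : ∀ i, A i) :
    IsPosElem (Matrix.fromBlocks (pCov Φ X X) (pCov Φ X Y) (pCov Φ Y X) (pCov Φ Y Y)) := by
  classical
  let u : (∀ i, A i) → Fin k → ∀ i, A i := fun Z i => Function.update (1 : ∀ i, A i) i (Z i)
  let v : Option (Fin k ⊕ Fin k) → ∀ i, A i := fun o => o.elim 1 (Sum.elim (u X) (u Y))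
  have hcard : Fintype.card (Option (Fin k ⊕ Fin k)) = 2 * k + 1 := by
    simp; omega
  let e : Option (Fin k ⊕ Fin k) ≃ Fin (2 * k + 1) := Fintype.equivFinOfCardEq hcard
  have hM : IsPosElem (Matrix.of fun a b : Fin (2 * k + 1) => star (v (e.symm a)) * v (e.symm b)) := by
    refine ⟨Matrix.of fun a b => if a = 0 then v (e.symm b) else 0, ?_⟩
    ext1 a b
    rw [Matrix.mul_apply, Finset.sum_eq_single 0]
    · simp [Matrix.star_apply]
    · intro l _ hl
      simp [hl]
    · simp
  obtain ⟨C, hC⟩ := h2k1 _ hM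
  have hC' : ∀ o o', (star C * C) (e o) (e o') = Φ (star (v o) * v o') := by
    intro o o'
    rw [← hC]; simp
  have hS := isPosElem_schur C (e none) (fun s : Fin k ⊕ Fin k => e (some s))
    ((hC' none none).trans (by simp [v, hunital]))
  simp only [← Matrix.star_eq_conjTranspose, hC'] at hS
  have hu : ∀ Z i, star (u Z i) = Function.update (1 : ∀ i, A i) i (star (Z i)) := by
    intro Z i
    ext j
    by_cases hj : j = i
    · subst hj; simp [u]
    · simp [u, hj]
  convert hS using 1
  ext (i | i) (j | j) <;> simp [pCov, v, hu] <;> rfl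
end

section
/- Let Φ : 𝒜₁ ⊕ ⋯ ⊕ 𝒜_k → ℬ be a unital positive (not necessarily linear or multilinear) map between unital C*-algebras with Φ(𝟎) = 0. If Φ is (k+1)-positive, then ᵖVar_Φ(𝐀) ≥ 0 in M_k(ℬ) for every 𝐀 ∈ ⊕ᵢ₌₁ᵏ𝒜ᵢ. In particular, if Φ is a unital positive multilinear map, then ᵖVar_Φ(𝐀) ≥ 0 for every normal element 𝐀 ∈ ⊕ᵢ₌₁ᵏ𝒜ᵢ. -/
section helpers

open scoped ComplexOrder

lemma nonneg_iff_posElem {C : Type*} [CStarAlgebra C] [PartialOrder C] [StarOrderedRing C] (a : C) :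
    0 ≤ a ↔ IsPosElem a := CStarAlgebra.nonneg_iff_eq_star_mul_self

open CStarMatrix in
lemma posElem_iff {B : Type*} [CStarAlgebra B] [PartialOrder B] [StarOrderedRing B] {n : ℕ}
    (M : Matrix (Fin n) (Fin n) B) : IsPosElem M ↔ 0 ≤ (ofMatrix M : CStarMatrix (Fin n) (Fin n) B) := by
  exact (nonneg_iff_posElem (C := CStarMatrix (Fin n) (Fin n) B) (ofMatrix M)).symm

open CStarMatrix in
lemma gram_nonneg {B : Type*} [CStarAlgebra B] [PartialOrder B] [StarOrderedRing B] {n : ℕ}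
    {ι : Type*} [Fintype ι] (d : ι → Fin n → B) :
    0 ≤ (ofMatrix (fun i j => ∑ r, star (d r i) * d r j) : CStarMatrix (Fin n) (Fin n) B) := by
  rcases n with _ | n
  · have : (ofMatrix (fun i j => ∑ r, star (d r i) * d r j) : CStarMatrix (Fin 0) (Fin 0) B) = 0 := by
      ext i; exact i.elim0
    rw [this]
  · have : (ofMatrix (fun i j => ∑ r, star (d r i) * d r j) : CStarMatrix (Fin (n+1)) (Fin (n+1)) B)
        = ∑ r, star (ofMatrix (fun i j => if i = 0 then d r j else 0) : CStarMatrix (Fin (n+1)) (Fin (n+1)) B)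
          * ofMatrix (fun i j => if i = 0 then d r j else 0) := by
      have happ : ∀ (s : Finset ι) (F : ι → CStarMatrix (Fin (n+1)) (Fin (n+1)) B) (i j : Fin (n+1)),
          (∑ r ∈ s, F r) i j = ∑ r ∈ s, F r i j := fun s F i j => Matrix.sum_apply i j s F
      ext i j
      rw [happ]
      refine Finset.sum_congr rfl fun r _ => ?_
      rw [CStarMatrix.mul_apply, Finset.sum_eq_single 0]
      · rw [CStarMatrix.star_apply]
        change _ = star (if (0 : Fin (n+1)) = 0 then d r i else 0) * (if (0 : Fin (n+1)) = 0 then d r j else 0)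
        simp
      · intro b _ hb
        change _ * (if b = 0 then d r j else 0) = 0
        simp [hb]
      · simp
    rw [this]
    exact Finset.sum_nonneg fun r _ => star_mul_self_nonneg _

lemma schur_pos {k : ℕ} {B : Type*} [CStarAlgebra B]
    (P : Matrix (Fin (k+1)) (Fin (k+1)) B) (hP : IsPosElem P) (h00 : P 0 0 = 1) :
    IsPosElem (Matrix.of fun i j : Fin k => P i.succ j.succ - P i.succ 0 * P 0 j.succ) := by
  let _ := CStarAlgebra.spectralOrder B
  have _ := CStarAlgebra.spectralOrderedRing B
  obtain ⟨b, hb⟩ := hP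
  have hP' : ∀ p q, P p q = ∑ r, star (b r p) * b r q := by
    intro p q; rw [hb]; simp [Matrix.mul_apply, Matrix.star_apply]
  have hs : ∀ p q, star (P p q) = P q p := by
    intro p q; rw [hP', hP']; simp
  rw [posElem_iff]
  suffices key : (Matrix.of fun i j : Fin k => P i.succ j.succ - P i.succ 0 * P 0 j.succ)
      = fun i j => ∑ r, star (b r i.succ - b r 0 * P 0 i.succ) *
        (b r j.succ - b r 0 * P 0 j.succ) by
    rw [key]
    exact gram_nonneg (fun r j => b r (Fin.succ j) - b r 0 * P 0 (Fin.succ j))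
  funext i j
  have e : ∀ r, star (b r i.succ - b r 0 * P 0 i.succ) * (b r j.succ - b r 0 * P 0 j.succ)
      = star (b r i.succ) * b r j.succ - (star (b r i.succ) * b r 0) * P 0 j.succ
        - P i.succ 0 * (star (b r 0) * b r j.succ) 
        + P i.succ 0 * (star (b r 0) * b r 0) * P 0 j.succ := by
    intro r
    rw [star_sub, star_mul, hs]; noncomm_ring
  simp only [e, Matrix.of_apply]
  rw [Finset.sum_add_distrib, Finset.sum_sub_distrib, Finset.sum_sub_distrib, ← Finset.sum_mul,
    ← Finset.sum_mul, ← Finset.mul_sum, ← Finset.mul_sum, ← hP', ← hP', ← hP', ← hP', h00]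
  noncomm_ring

open Classical in
lemma exists_approx {K : Type*} [TopologicalSpace K] [CompactSpace K] [T2Space K] {ι : Type*} [Finite ι]
    (g : ι → C(K, ℂ)) (ε : ℝ) (hε : 0 < ε) :
    ∃ (S : Finset K) (u : K → C(K, ℂ)), (∀ s, 0 ≤ u s) ∧
      ∀ i, ‖g i - ∑ s ∈ S, g i s • u s‖ ≤ ε := by
  have hU : ∀ s : K, IsOpen {x | ∀ i, ‖g i x - g i s‖ < ε} := by
    intro s
    rw [Set.ofPred_forall]
    exact isOpen_iInter_of_finite fun i => isOpen_lt (by fun_prop) continuous_const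
  obtain ⟨S, hS⟩ := isCompact_univ.elim_finite_subcover _ hU (fun x _ => by
    simp only [Set.mem_iUnion]; exact ⟨x, fun i => by simpa using hε⟩)
  obtain ⟨ρ, hρ⟩ := PartitionOfUnity.exists_isSubordinate (X := K) isClosed_univ
    (fun s : S => {x | ∀ i, ‖g i x - g i s‖ < ε}) (fun s => hU s) (by
      intro x hx; simpa using hS hx)
  let v : S → C(K, ℂ) := fun s => ⟨fun x => (ρ s x : ℂ), by fun_prop⟩
  let u : K → C(K, ℂ) := fun s => if h : s ∈ S then v ⟨s, h⟩ else 0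
  refine ⟨S, u, ?_, ?_⟩
  · intro s
    by_cases h : s ∈ S
    · simp only [u, h, dif_pos]
      intro x
      have := ρ.nonneg ⟨s, h⟩ x
      change (0:ℂ) ≤ ((ρ ⟨s, h⟩ x : ℝ) : ℂ)
      exact_mod_cast this
    · simp [u, h]
  · intro i
    rw [ContinuousMap.norm_le _ hε.le]
    intro x
    have h1 : ∑ s : S, ρ s x = 1 := by
      rw [← finsum_eq_sum_of_fintype]; exact ρ.sum_eq_one (Set.mem_univ x)
    have h2 : (g i - ∑ s ∈ S, g i s • u s) x = ∑ s : S, (ρ s x : ℂ) * (g i x - g i s) := by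
      simp only [mul_sub, Finset.sum_sub_distrib, ← Finset.sum_mul]
      rw [← Complex.ofReal_sum, h1, ← Finset.sum_coe_sort]
      simp [u, v, mul_comm]
    rw [h2]
    calc _ ≤ ∑ s : S, ρ s x * ε := by
            refine (norm_sum_le _ _).trans (Finset.sum_le_sum fun s _ => ?_)
            rw [norm_mul, Complex.norm_real, Real.norm_of_nonneg (ρ.nonneg s x)]
            by_cases hz : ρ s x = 0
            · simp [hz]
            · have : x ∈ {x | ∀ i, ‖g i x - g i s‖ < ε} :=
                hρ s (subset_tsupport _ hz)
              exact mul_le_mul_of_nonneg_left (this i).le (ρ.nonneg s x)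
      _ = ε := by rw [← Finset.sum_mul, h1, one_mul]

open CStarMatrix in
lemma schur_map_nonneg {B : Type*} [CStarAlgebra B] [PartialOrder B] [StarOrderedRing B] {n : ℕ}
    {K : Type*} [TopologicalSpace K] [CompactSpace K] [T2Space K]
    (ψ : C(K, ℂ) →ₗ[ℂ] CStarMatrix (Fin n) (Fin n) B) (hψ : ∀ f, 0 ≤ f → 0 ≤ ψ f)
    (f : Fin n → C(K, ℂ)) :
    0 ≤ (ofMatrix (fun p q => ψ (star (f p) * f q) p q) : CStarMatrix (Fin n) (Fin n) B) := by
  have hc : Continuous ψ := map_continuous (PositiveLinearMap.mk₀ ψ hψ)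
  have happ : ∀ (s : Finset K) (F : K → CStarMatrix (Fin n) (Fin n) B) (i j : Fin n),
          (∑ r ∈ s, F r) i j = ∑ r ∈ s, F r i j := fun s F i j => Matrix.sum_apply i j s F
  let g : Fin n × Fin n → C(K, ℂ) := fun pq => star (f pq.1) * f pq.2
  have H := fun m : ℕ => exists_approx g (1 / ((m : ℝ) + 1)) (by positivity)
  choose S u hu hgu using H
  let N : ℕ → CStarMatrix (Fin n) (Fin n) B := fun m =>
    ofMatrix (fun p q => ψ (∑ s ∈ S m, g (p, q) s • u m s) p q)
  have hN : ∀ m, 0 ≤ N m := by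
    intro m
    have : N m = ∑ s ∈ S m, star (ofMatrix (Matrix.diagonal fun p => algebraMap ℂ B (f p s)))
        * ψ (u m s) * ofMatrix (Matrix.diagonal fun p => algebraMap ℂ B (f p s)) := by
      ext p q
      rw [happ]
      change ψ (∑ s ∈ S m, g (p, q) s • u m s) p q = _
      rw [map_sum, happ]
      refine Finset.sum_congr rfl fun s _ => ?_
      rw [map_smul]
      let Z : Matrix (Fin n) (Fin n) B := ofMatrix.symm (ψ (u m s))
      let D : Fin n → B := fun p => algebraMap ℂ B (f p s)
      change g (p, q) s • Z p q = (((Matrix.diagonal D).conjTranspose * Z) * Matrix.diagonal D) p q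
      rw [Matrix.mul_diagonal, Matrix.diagonal_conjTranspose, Matrix.diagonal_mul]
      have e1 : star D p = algebraMap ℂ B (star (f p s)) := by
        exact (algebraMap_star_comm (A := B) (f p s)).symm
      rw [e1, mul_assoc, ← Algebra.commutes (f q s) (Z p q), ← mul_assoc, ← map_mul, Algebra.smul_def]
      rfl
    rw [this]
    exact Finset.sum_nonneg fun s _ => star_left_conjugate_nonneg (hψ _ (hu m s)) _
  refine ge_of_tendsto (x := Filter.atTop) (f := N) ?_ (Filter.Eventually.of_forall hN)
  have hent : ∀ p q, Filter.Tendsto (fun m => N m p q) Filter.atTop (nhds (ψ (g (p,q)) p q)) := by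
    intro p q
    have h1 : Filter.Tendsto (fun m => ∑ s ∈ S m, g (p, q) s • u m s) Filter.atTop (nhds (g (p,q))) := by
      rw [tendsto_iff_norm_sub_tendsto_zero]
      refine squeeze_zero (fun _ => norm_nonneg _) (fun m => ?_) tendsto_one_div_add_atTop_nhds_zero_nat
      rw [norm_sub_rev]; exact hgu m (p, q)
    have h2 := (hc.tendsto _).comp h1
    exact tendsto_pi_nhds.1 (tendsto_pi_nhds.1 h2 p) q
  exact tendsto_pi_nhds.2 fun p => tendsto_pi_nhds.2 fun q => hent p q

open CStarMatrix in
lemma multilinear_gram {k n : ℕ} {A : Fin k → Type*} [∀ i, CStarAlgebra (A i)] {B : Type*}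
    [CStarAlgebra B] [PartialOrder B] [StarOrderedRing B]
    (Φ : (∀ i, A i) → B)
    (hpos : ∀ x : ∀ i, A i, IsPosElem x → IsPosElem (Φ x))
    (hlin : ∀ (j : Fin k) (x : ∀ i, A i),
        IsLinearMap ℂ (fun a : A j => Φ (Function.update x j a)))
    (K : Fin k → Type*) [∀ i, TopologicalSpace (K i)] [∀ i, CompactSpace (K i)]
    [∀ i, T2Space (K i)] (π : ∀ i, C(K i, ℂ) →⋆ₐ[ℂ] A i)
    (c : Fin n → ∀ i, C(K i, ℂ)) (S : Finset (Fin k)) :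
    ∀ u : ∀ i, A i, (∀ i, IsPosElem (u i)) →
      0 ≤ (ofMatrix (fun p q => Φ (fun i => if i ∈ S then π i (star (c p i) * c q i) else u i)) :
        CStarMatrix (Fin n) (Fin n) B) := by
  induction S using Finset.induction_on with
  | empty =>
    intro u hu
    choose v hv using hu
    obtain ⟨b, hb⟩ := hpos u ⟨v, funext hv⟩
    have := gram_nonneg (n := n) (fun (_ : Unit) (_ : Fin n) => b)
    simpa [hb] using this
  | insert j S hj ih =>
    intro u hu
    let base : Fin n → Fin n → ∀ i, A i := fun p q i =>
      if i ∈ S then π i (star (c p i) * c q i) else u i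
    let ψ : C(K j, ℂ) →ₗ[ℂ] CStarMatrix (Fin n) (Fin n) B :=
      { toFun := fun h => ofMatrix fun p q => Φ (Function.update (base p q) j (π j h))
        map_add' := by
          intro x y
          ext p q
          have := (hlin j (base p q)).map_add (π j x) (π j y)
          rw [← map_add] at this
          exact this
        map_smul' := by
          intro a x
          ext p q
          have := (hlin j (base p q)).map_smul a (π j x)
          rw [← map_smul] at this
          exact this }
    have hψ : ∀ h, 0 ≤ h → 0 ≤ ψ h := by
      intro h hh
      obtain ⟨b, hb⟩ := (nonneg_iff_posElem h).1 hh
      have := ih (Function.update u j (π j h)) (by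
        intro i
        by_cases hi : i = j
        · subst hi
          rw [Function.update_self]
          exact ⟨π i b, by rw [hb, map_mul, map_star]⟩
        · rw [Function.update_of_ne hi]; exact hu i)
      convert this using 1
      ext p q
      change Φ _ = Φ _
      congr 1
      funext i
      by_cases hi : i = j
      · subst hi; simp [hj]
      · simp [base, hi]
    have := schur_map_nonneg ψ hψ (fun p => c p j)
    convert this using 1
    ext p q
    change Φ _ = Φ _
    congr 1
    funext i
    by_cases hi : i = j
    · subst hi; simp
    · simp [base, hi]

end helpers

/-- Theorem 4.6 (ii): let `Φ : 𝒜₁ ⊕ ⋯ ⊕ 𝒜_k → ℬ` be a unital positive (not necessarily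
linear or multilinear) map with `Φ(𝟎) = 0`.  If `Φ` is `(k+1)`-positive, then
`ᵖVar_Φ(𝐀) ≥ 0` in `M_k(ℬ)` for every `𝐀`; in particular, if `Φ` is a unital positive
multilinear map, then `ᵖVar_Φ(𝐀) ≥ 0` for every normal element `𝐀`. -/
theorem partial_variance_positive
    {k : ℕ} {A : Fin k → Type*} [∀ i, CStarAlgebra (A i)] {B : Type*} [CStarAlgebra B]
    (Φ : (∀ i, A i) → B) (hunital : Φ 1 = 1)
    (hpos : ∀ x : ∀ i, A i, IsPosElem x → IsPosElem (Φ x)) (h0 : Φ 0 = 0) :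
    (IsNPosMap (k + 1) Φ → ∀ X : ∀ i, A i, IsPosElem (pCov Φ X X)) ∧
    ((∀ (j : Fin k) (x : ∀ i, A i),
        IsLinearMap ℂ (fun a : A j => Φ (Function.update x j a))) →
      ∀ X : ∀ i, A i, star X * X = X * star X → IsPosElem (pCov Φ X X)) := by
  have hstar : ∀ (X : ∀ i, A i) (i : Fin k),
      star (Function.update (1 : ∀ i, A i) i (X i)) = Function.update (1 : ∀ i, A i) i (star (X i)) := by
    intro X i
    funext l
    by_cases h : l = i
    · subst h; simp
    · simp [h]
  have hmain : ∀ (X : ∀ i, A i) (F : Fin (k + 1) → ∀ i, A i), F 0 = 1 →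
      (∀ j : Fin k, F j.succ = Function.update (1 : ∀ i, A i) j (X j)) →
      IsPosElem (Matrix.of fun p q => Φ (star (F p) * F q)) → IsPosElem (pCov Φ X X) := by
    intro X F hF0 hF1 hP
    have := schur_pos _ hP (by simp [hF0, hunital])
    simpa [pCov, hF0, hF1, hstar] using this
  refine ⟨fun hn X => ?_, fun hlin X hX => ?_⟩
  · let F : Fin (k + 1) → ∀ i, A i := Fin.cons 1 fun j => Function.update 1 j (X j)
    refine hmain X F rfl (fun j => rfl) ?_
    refine hn (Matrix.of fun p q => star (F p) * F q) ⟨Matrix.of fun p q => if p = 0 then F q else 0, ?_⟩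
    ext1 p q
    simp [Matrix.mul_apply, Matrix.star_apply]
  · have hXn : ∀ i, IsStarNormal (X i) := fun i => ⟨congrFun hX i⟩
    let _ := CStarAlgebra.spectralOrder B
    have _ := CStarAlgebra.spectralOrderedRing B
    let c : Fin (k + 1) → ∀ i, C(spectrum ℂ (X i), ℂ) := Fin.cons 1 fun j =>
      Function.update 1 j ((ContinuousMap.id ℂ).restrict (spectrum ℂ (X j)))
    let F : Fin (k + 1) → ∀ i, A i := fun p i => cfcHom (hXn i) (c p i)
    refine hmain X F ?_ ?_ ?_
    · funext i; simp [F, c]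
    · intro j
      funext i
      by_cases h : i = j
      · subst h; simp [F, c, cfcHom_id]
      · simp [F, c, h]
    · have := multilinear_gram Φ hpos hlin _ (fun i => cfcHom (hXn i)) c Finset.univ 0
        (fun i => ⟨0, by simp⟩)
      rw [posElem_iff]
      convert this using 1
      ext p q
      change Φ _ = Φ _
      congr 1
      funext i
      simp [F, map_star]
end
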